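/- arXiv:2308.05299 — 3 statements merged into one kernel-verified Lean document; each statement's English description precedes it below -/
import Mathlib

section
/- Let R be a G-graded domain. If R is a graded perinormal domain, then R is weakly normal. -/
/-! Core definitions for graded perinormality, following Epstein–Shapiro style graded notions. -/

section Core

variable {ι : Type*} [DecidableEq ι] [AddCommMonoid ι]
variable {R : Type*} [CommRing R]

/-- `𝒜` is a grading of the ring `R` by the (torsionless) monoid `ι`:
the components multiply correctly and give an internal direct sum decomposition. -/
structure IsGrRing (𝒜 : ι → AddSubgroup R) : Prop where
  one_mem : (1 : R) ∈ 𝒜 0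
  mul_mem : ∀ {i j : ι} {a b : R}, a ∈ 𝒜 i → b ∈ 𝒜 j → a * b ∈ 𝒜 (i + j)
  internal : DirectSum.IsInternal 𝒜

/-- An ideal of `R` is homogeneous iff every element of it is a finite sum of
homogeneous elements of the ideal. -/
def IsHomIdeal (𝒜 : ι → AddSubgroup R) (I : Ideal R) : Prop :=
  ∀ x ∈ I, x ∈ AddSubmonoid.closure {y : R | SetLike.IsHomogeneousElem 𝒜 y ∧ y ∈ I}

/-- A graded (homogeneous) maximal ideal: maximal among proper homogeneous ideals. -/
def IsGrMaxIdeal (𝒜 : ι → AddSubgroup R) (I : Ideal R) : Prop :=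
  IsHomIdeal 𝒜 I ∧ I ≠ ⊤ ∧ ∀ J : Ideal R, IsHomIdeal 𝒜 J → I ≤ J → J ≠ ⊤ → J = I

/-- `R` is gr-local: it has exactly one graded maximal ideal. -/
def GrLocal (𝒜 : ι → AddSubgroup R) : Prop :=
  ∃! I : Ideal R, IsGrMaxIdeal 𝒜 I

/-- A prime ideal of height one (in a domain). -/
def HeightOnePrime (P : Ideal R) : Prop :=
  P.IsPrime ∧ P ≠ ⊥ ∧ ∀ Q : Ideal R, Q.IsPrime → Q < P → Q = ⊥

variable [IsDomain R]

/-- A homogeneous element of the graded quotient field of `R`, i.e. a quotient of two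
homogeneous elements of `R` (viewed inside the full quotient field). -/
def IsHomFrac (𝒜 : ι → AddSubgroup R) (x : FractionRing R) : Prop :=
  ∃ (i j : ι) (a b : R), a ∈ 𝒜 i ∧ b ∈ 𝒜 j ∧ b ≠ 0 ∧
    x * algebraMap R (FractionRing R) b = algebraMap R (FractionRing R) a

/-- `S` is a graded overring of `R`: a ring between `R` and the graded quotient field that is
the sum of its homogeneous components, i.e. each of its elements is a finite sum of
homogeneous elements of `S`. -/
def IsGradedOverring (𝒜 : ι → AddSubgroup R) (S : Subalgebra R (FractionRing R)) : Prop :=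
  ∀ x ∈ S, x ∈ AddSubmonoid.closure {y : FractionRing R | y ∈ S ∧ IsHomFrac 𝒜 y}

/-- A homogeneous ideal of an overring `S` of `R`. -/
def IsHomIdealOver (𝒜 : ι → AddSubgroup R) (S : Subalgebra R (FractionRing R))
    (I : Ideal S) : Prop :=
  ∀ x ∈ I, (x : FractionRing R) ∈ AddSubmonoid.closure
    {y : FractionRing R | IsHomFrac 𝒜 y ∧ ∃ h : y ∈ S, (⟨y, h⟩ : S) ∈ I}

/-- A graded maximal ideal of an overring. -/
def IsGrMaxIdealOver (𝒜 : ι → AddSubgroup R) (S : Subalgebra R (FractionRing R))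
    (I : Ideal S) : Prop :=
  IsHomIdealOver 𝒜 S I ∧ I ≠ ⊤ ∧
    ∀ J : Ideal S, IsHomIdealOver 𝒜 S J → I ≤ J → J ≠ ⊤ → J = I

/-- The overring `S` is gr-local. -/
def GrLocalOver (𝒜 : ι → AddSubgroup R) (S : Subalgebra R (FractionRing R)) : Prop :=
  ∃! I : Ideal S, IsGrMaxIdealOver 𝒜 S I

/-- `S` satisfies graded going-down (gGD) over `R`. -/
def GGD (𝒜 : ι → AddSubgroup R) (S : Subalgebra R (FractionRing R)) : Prop :=
  ∀ (P Q : Ideal R) (Qt : Ideal S), P.IsPrime → Q.IsPrime → Qt.IsPrime →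
    IsHomIdeal 𝒜 P → IsHomIdeal 𝒜 Q → IsHomIdealOver 𝒜 S Qt → P ≤ Q →
    Qt.comap (algebraMap R S) = Q →
    ∃ Pt : Ideal S, Pt.IsPrime ∧ IsHomIdealOver 𝒜 S Pt ∧ Pt ≤ Qt ∧
      Pt.comap (algebraMap R S) = P

/-- The overring `S` is a localization of `R` (at some multiplicative subset `W` of `R`). -/
def IsLocalizationOfR (S : Subalgebra R (FractionRing R)) : Prop :=
  ∃ W : Submonoid R, (∀ w ∈ W, IsUnit (algebraMap R S w)) ∧
    ∀ s : S, ∃ (r w : R), w ∈ W ∧ s * algebraMap R S w = algebraMap R S r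

/-- `R` is a graded perinormal domain: every gr-local graded overring satisfying gGD is a
localization of `R`. -/
def GradedPerinormal (𝒜 : ι → AddSubgroup R) : Prop :=
  ∀ S : Subalgebra R (FractionRing R),
    IsGradedOverring 𝒜 S → GrLocalOver 𝒜 S → GGD 𝒜 S → IsLocalizationOfR S

/-- `R` is a graded globally perinormal domain: every graded overring satisfying gGD is a
localization of `R`. -/
def GradedGloballyPerinormal (𝒜 : ι → AddSubgroup R) : Prop :=
  ∀ S : Subalgebra R (FractionRing R),
    IsGradedOverring 𝒜 S → GGD 𝒜 S → IsLocalizationOfR S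

/-- The homogeneous localization `R_(P)` of `R` at an ideal `P`: the subring of the graded
quotient field consisting of fractions with homogeneous denominator outside `P`. -/
def HomLocR (𝒜 : ι → AddSubgroup R) (P : Ideal R) : Subalgebra R (FractionRing R) :=
  Algebra.adjoin R {x : FractionRing R | ∃ a w : R, SetLike.IsHomogeneousElem 𝒜 w ∧ w ∉ P ∧
    x * algebraMap R (FractionRing R) w = algebraMap R (FractionRing R) a}

/-- The homogeneous localization `S_(Q)` of an overring `S` at an ideal `Q` of `S`. -/
def HomLocOver (𝒜 : ι → AddSubgroup R) (S : Subalgebra R (FractionRing R)) (Q : Ideal S) :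
    Subalgebra R (FractionRing R) :=
  Algebra.adjoin R {x : FractionRing R | ∃ s w : S, IsHomFrac 𝒜 (w : FractionRing R) ∧
    w ∉ Q ∧ x * (w : FractionRing R) = (s : FractionRing R)}

/-- The localization `R_W` of `R` at a multiplicative set `W`, as a subring of the quotient
field. -/
def LocW (W : Submonoid R) : Subalgebra R (FractionRing R) :=
  Algebra.adjoin R {x : FractionRing R | ∃ r : R, ∃ w ∈ W,
    x * algebraMap R (FractionRing R) w = algebraMap R (FractionRing R) r}

/-- A subring `V` of the graded quotient field (containing `R`) is a gr-valuation domain: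
for every nonzero homogeneous `x` of the graded quotient field, `x ∈ V` or `x⁻¹ ∈ V`. -/
def GrValuation (𝒜 : ι → AddSubgroup R) (V : Subalgebra R (FractionRing R)) : Prop :=
  ∀ x : FractionRing R, x ≠ 0 → IsHomFrac 𝒜 x → x ∈ V ∨ x⁻¹ ∈ V

/-- `R` is a gr-(R₁) domain: the homogeneous localization at every height-one homogeneous
prime is a gr-valuation domain. -/
def GrR1 (𝒜 : ι → AddSubgroup R) : Prop :=
  ∀ P : Ideal R, HeightOnePrime P → IsHomIdeal 𝒜 P → GrValuation 𝒜 (HomLocR 𝒜 P)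

/-- The ideal `I` of `T` is the contraction of the ideal `J` of `S` (that is, `I = J ∩ T`
inside the common quotient field). -/
def Contracts (T S : Subalgebra R (FractionRing R)) (J : Ideal S) (I : Ideal T) : Prop :=
  ∀ x : FractionRing R,
    (∃ h : x ∈ T, (⟨x, h⟩ : T) ∈ I) ↔ (x ∈ T ∧ ∃ h : x ∈ S, (⟨x, h⟩ : S) ∈ J)

/-- `S` satisfies graded going-down over the intermediate ring `T`. -/
def GGDSub (𝒜 : ι → AddSubgroup R) (T S : Subalgebra R (FractionRing R)) : Prop :=
  ∀ (P Q : Ideal T) (Qt : Ideal S), P.IsPrime → Q.IsPrime → Qt.IsPrime →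
    IsHomIdealOver 𝒜 T P → IsHomIdealOver 𝒜 T Q → IsHomIdealOver 𝒜 S Qt → P ≤ Q →
    Contracts T S Qt Q →
    ∃ Pt : Ideal S, Pt.IsPrime ∧ IsHomIdealOver 𝒜 S Pt ∧ Pt ≤ Qt ∧ Contracts T S Pt P

/-- `S` is a localization of the intermediate ring `T` at a multiplicative subset of `T`. -/
def IsLocalizationOfSub (T S : Subalgebra R (FractionRing R)) : Prop :=
  ∃ W : Submonoid (FractionRing R), (W : Set (FractionRing R)) ⊆ T ∧
    (∀ w ∈ W, ∃ y ∈ S, w * y = 1) ∧ ∀ s ∈ S, ∃ t ∈ T, ∃ w ∈ W, s * w = t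

/-- The intermediate ring `T` (e.g. a homogeneous localization of `R`) is a graded
perinormal domain. -/
def GradedPerinormalSub (𝒜 : ι → AddSubgroup R) (T : Subalgebra R (FractionRing R)) : Prop :=
  ∀ S : Subalgebra R (FractionRing R), T ≤ S → IsGradedOverring 𝒜 S → GrLocalOver 𝒜 S →
    GGDSub 𝒜 T S → IsLocalizationOfSub T S

/-- The intermediate ring `T` is a graded globally perinormal domain. -/
def GradedGloballyPerinormalSub (𝒜 : ι → AddSubgroup R)
    (T : Subalgebra R (FractionRing R)) : Prop :=
  ∀ S : Subalgebra R (FractionRing R), T ≤ S → IsGradedOverring 𝒜 S →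
    GGDSub 𝒜 T S → IsLocalizationOfSub T S

/-- `R` is a gr-essential domain: `R` is the intersection of homogeneous localizations at a
family of homogeneous primes, each of which is a gr-valuation domain. -/
def GrEssential (𝒜 : ι → AddSubgroup R) : Prop :=
  ∃ I : Set (Ideal R),
    (∀ P ∈ I, P.IsPrime ∧ IsHomIdeal 𝒜 P ∧ GrValuation 𝒜 (HomLocR 𝒜 P)) ∧
    ((⊥ : Subalgebra R (FractionRing R)) : Set (FractionRing R)) =
      ⋂ P ∈ I, (HomLocR 𝒜 P : Set (FractionRing R))

/-- The intermediate ring `T` is a gr-essential domain. -/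
def GrEssentialSub (𝒜 : ι → AddSubgroup R) (T : Subalgebra R (FractionRing R)) : Prop :=
  ∃ I : Set (Ideal T),
    (∀ P ∈ I, P.IsPrime ∧ IsHomIdealOver 𝒜 T P ∧ GrValuation 𝒜 (HomLocOver 𝒜 T P)) ∧
    (T : Set (FractionRing R)) = ⋂ P ∈ I, (HomLocOver 𝒜 T P : Set (FractionRing R))

end Core

/-- The residue field extension `R_{Q ∩ R}/(Q ∩ R)R_{Q ∩ R} → S_Q/QS_Q` induced by `f : R → S`
at a prime `Q` of `S` is purely inseparable. -/
def PurelyInsepResidue {A B : Type*} [CommRing A] [CommRing B] (f : A →+* B)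
    (Q : Ideal B) (hQ : Q.IsPrime) : Prop :=
  letI := hQ
  letI : (Q.comap f).IsPrime := Ideal.IsPrime.comap f
  letI : IsLocalHom (Localization.localRingHom (Q.comap f) Q f rfl) :=
    Localization.isLocalHom_localRingHom _ _ _ rfl
  letI := (IsLocalRing.ResidueField.map (Localization.localRingHom (Q.comap f) Q f rfl)).toAlgebra
  IsPurelyInseparable (IsLocalRing.ResidueField (Localization.AtPrime (Q.comap f)))
    (IsLocalRing.ResidueField (Localization.AtPrime Q))

/-- An integral domain `R` is weakly normal if `S = R` for every integral overring `S` of `R`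
such that `Spec S → Spec R` is a bijection and all induced residue field extensions are purely
inseparable. -/
def WeaklyNormal (R : Type*) [CommRing R] [IsDomain R] : Prop :=
  ∀ S : Subalgebra R (FractionRing R),
    (∀ s : S, IsIntegral R s) →
    Function.Bijective (PrimeSpectrum.comap (algebraMap R S)) →
    (∀ (Q : Ideal S) (hQ : Q.IsPrime), PurelyInsepResidue (algebraMap R S) Q hQ) →
    S = ⊥

open scoped AddMonoidAlgebra

/-- A torsion-free abelian group has unique sums, since it embeds into a rational vector space. -/
theorem uniqueSums_of_isAddTorsionFree (G : Type*) [AddCommGroup G] [IsAddTorsionFree G] :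
    UniqueSums G :=
  have : TwoUniqueSums G := TwoUniqueSums.of_injective_addHom
    (DivisibleHull.coeAddMonoidHom (M := G)).toAddHom DivisibleHull.coe_injective inferInstance
  inferInstance

/-- A domain each of whose finite subsets lies in an integrally closed subring is
integrally closed. -/
theorem IsIntegrallyClosed.of_forall_finset_subset_subring {D : Type*} [CommRing D] [IsDomain D]
    (h : ∀ s : Finset D, ∃ E : Subring D, (s : Set D) ⊆ E ∧ IsIntegrallyClosed E) :
    IsIntegrallyClosed D := by
  classical
  let L := FractionRing D
  refine (isIntegrallyClosed_iff L).mpr fun {y} hy ↦ ?_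
  obtain ⟨P, hP, hPy⟩ := hy
  obtain ⟨p, q, hq, rfl⟩ := IsFractionRing.div_surjective (A := D) y
  obtain ⟨E, hE, hEc⟩ := h (insert p (insert q P.coeffs))
  have hp : p ∈ E := hE (by simp)
  have hqE : q ∈ E := hE (by simp)
  have hPE : (P.coeffs : Set D) ⊆ E := fun c hc ↦ hE (by
    simp only [Finset.coe_insert]; exact Or.inr (Or.inr hc))
  have hinj : Function.Injective ((algebraMap D L).comp E.subtype) :=
    (IsFractionRing.injective D L).comp Subtype.val_injective
  let φ : FractionRing E →+* L := IsFractionRing.lift hinj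
  have hφ : ∀ e : E, φ (algebraMap E _ e) = algebraMap D L e := fun e ↦
    IsFractionRing.lift_algebraMap hinj e
  let y' : FractionRing E := algebraMap E _ ⟨p, hp⟩ / algebraMap E _ ⟨q, hqE⟩
  have hy' : φ y' = algebraMap D L p / algebraMap D L q := by
    simp only [y', map_div₀, hφ]
  have hint : IsIntegral E y' := by
    refine ⟨P.toSubring E hPE, (Polynomial.monic_toSubring _ _ _).mpr hP, φ.injective ?_⟩
    rw [map_zero, Polynomial.hom_eval₂, hy', ← hPy]
    have hc : φ.comp (algebraMap E (FractionRing E)) = (algebraMap D L).comp E.subtype :=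
      RingHom.ext hφ
    rw [hc, ← Polynomial.eval₂_map, Polynomial.map_toSubring]
  obtain ⟨e, he⟩ := (isIntegrallyClosed_iff (FractionRing E)).mp hEc hint
  exact ⟨e, by rw [← hφ, he, hy']⟩

/-- Laurent polynomials over an integrally closed domain form an integrally closed domain. -/
theorem isIntegrallyClosed_addMonoidAlgebra_int (A : Type*) [CommRing A] [IsDomain A]
    [IsIntegrallyClosed A] : IsIntegrallyClosed A[ℤ] := by
  have : IsLocalization.Away (Polynomial.X : Polynomial A) (LaurentPolynomial A) := inferInstance
  exact isIntegrallyClosed_of_isLocalization (LaurentPolynomial A)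
    (Submonoid.powers (Polynomial.X : Polynomial A))
    (powers_le_nonZeroDivisors_of_noZeroDivisors Polynomial.X_ne_zero)

theorem isIntegrallyClosed_addMonoidAlgebra_pi_int (A : Type*) [CommRing A] [IsDomain A]
    [IsIntegrallyClosed A] (n : ℕ) : IsIntegrallyClosed A[Fin n → ℤ] := by
  induction n with
  | zero => exact .of_equiv (AddMonoidAlgebra.uniqueRingEquiv (R := A) (Fin 0 → ℤ)).symm
  | succ n ih =>
    have := isIntegrallyClosed_addMonoidAlgebra_int A[Fin n → ℤ]
    let e : ℤ × (Fin n → ℤ) ≃+ (Fin (n + 1) → ℤ) :=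
      { Fin.consEquiv fun _ ↦ ℤ with
        map_add' := fun x y ↦ by
          funext i
          refine Fin.cases ?_ (fun j ↦ ?_) i <;> simp [Fin.consEquiv] }
    have : IsIntegrallyClosed A[ℤ × (Fin n → ℤ)] :=
      .of_equiv (AddMonoidAlgebra.curryRingEquiv (R := A) (M := ℤ) (N := Fin n → ℤ)).symm
    exact .of_equiv (AddMonoidAlgebra.mapDomainRingEquiv A e)

/-- The group algebra of a torsion-free abelian group over an integrally closed domain is
integrally closed. -/
theorem isIntegrallyClosed_addMonoidAlgebra (A G : Type*) [CommRing A] [IsDomain A]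
    [IsIntegrallyClosed A] [AddCommGroup G] [IsAddTorsionFree G] : IsIntegrallyClosed A[G] := by
  classical
  have := uniqueSums_of_isAddTorsionFree G
  refine .of_forall_finset_subset_subring fun s ↦ ?_
  let H : AddSubgroup G := AddSubgroup.closure (s.biUnion fun x ↦ x.coeff.support : Finset G)
  have hfg : AddGroup.FG H := (AddGroup.fg_iff_addSubgroup_fg H).mpr ⟨_, rfl⟩
  have : Module.Finite ℤ H := Module.Finite.iff_addGroup_fg.mpr hfg
  let e : (Fin (Module.finrank ℤ H) → ℤ) ≃+ H :=
    (Module.finBasis ℤ H).equivFun.symm.toAddEquiv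
  have := isIntegrallyClosed_addMonoidAlgebra_pi_int A (Module.finrank ℤ H)
  have hH : IsIntegrallyClosed A[H] := .of_equiv (AddMonoidAlgebra.mapDomainRingEquiv A e)
  let φ : A[H] →+* A[G] := AddMonoidAlgebra.mapDomainRingHom A H.subtype
  have hφ : Function.Injective φ := AddMonoidAlgebra.mapDomain_injective Subtype.val_injective
  refine ⟨φ.range, fun x hx ↦ ?_, .of_equiv (RingEquiv.ofBijective φ.rangeRestrict
    ⟨fun a b hab ↦ hφ (congrArg Subtype.val hab), φ.rangeRestrict_surjective⟩)⟩
  refine ⟨AddMonoidAlgebra.comapDomain _ Subtype.val_injective x,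
    AddMonoidAlgebra.mapDomain_comapDomain (fun g hg ↦ ?_) _⟩
  refine ⟨⟨g, AddSubgroup.subset_closure ?_⟩, rfl⟩
  simp only [Finset.coe_biUnion, Set.mem_iUnion]
  exact ⟨x, hx, hg⟩

/-- The augmentation of a group algebra: the sum of the coefficients. -/
noncomputable def augmentation (A G : Type*) [CommRing A] [AddCommGroup G] : A[G] →+* A :=
  AddMonoidAlgebra.liftNCRingHom (RingHom.id A) 1 fun _ _ ↦ Commute.all _ _

@[simp]
theorem augmentation_single {A G : Type*} [CommRing A] [AddCommGroup G] (g : G) (a : A) :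
    augmentation A G (.single g a) = a := by
  simp [augmentation]

theorem augmentation_eq_sum {A G : Type*} [CommRing A] [AddCommGroup G] (x : A[G]) :
    augmentation A G x = x.coeff.sum fun _ a ↦ a := by
  conv_lhs => rw [← AddMonoidAlgebra.sum_coeff_single x]
  simp [Finsupp.sum, map_sum]

theorem augmentation_mapRingHom {A B G : Type*} [CommRing A] [CommRing B] [AddCommGroup G]
    (f : A →+* B) (x : A[G]) :
    augmentation B G (AddMonoidAlgebra.mapRingHom G f x) = f (augmentation A G x) := by
  induction x using AddMonoidAlgebra.induction_linear with
  | zero => simp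
  | add x y hx hy => simp only [map_add, hx, hy]
  | single m r => simp

section Coaction

variable {G : Type*} [DecidableEq G] [AddCommGroup G] {R : Type*} [CommRing R]
  {𝒜 : G → AddSubgroup R}

theorem IsGrRing.exists_coaction (hGr : IsGrRing 𝒜) :
    ∃ δ : R →+* R[G], (∀ i, ∀ r ∈ 𝒜 i, δ r = .single i r) ∧
      (∀ r i, (δ r).coeff i ∈ 𝒜 i) ∧ ∀ r, augmentation R G (δ r) = r := by
  let := hGr.internal.chooseDecomposition
  let : GradedRing 𝒜 := { one_mem := hGr.one_mem, mul_mem := fun _ _ _ _ ↦ hGr.mul_mem }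
  let φ := DirectSum.toSemiring
    (fun i ↦ (AddMonoidAlgebra.singleAddHom (R := R) i).comp (𝒜 i).subtype) (by rfl)
    (fun ai aj ↦ by simp)
  let δ : R →+* R[G] := φ.comp (DirectSum.decomposeRingEquiv 𝒜).toRingHom
  have hδ : ∀ i, ∀ r ∈ 𝒜 i, δ r = .single i r := by
    intro i r hr
    have : DirectSum.decompose 𝒜 r = DirectSum.of _ i ⟨r, hr⟩ := DirectSum.decompose_of_mem 𝒜 hr
    change φ (DirectSum.decompose 𝒜 r) = _
    rw [this]
    exact DirectSum.toSemiring_of _ _ _ _ _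
  refine ⟨δ, hδ, fun r ↦ ?_, fun r ↦ ?_⟩
  · induction r using DirectSum.Decomposition.inductionOn 𝒜 with
    | zero => simp [zero_mem]
    | @homogeneous j m =>
      intro i
      rw [hδ j m m.2]
      by_cases h : j = i
      · subst h; simp
      · simp [h, zero_mem]
    | add m m' h h' => intro i; simpa using add_mem (h i) (h' i)
  · induction r using DirectSum.Decomposition.inductionOn 𝒜 with
    | zero => simp
    | @homogeneous j m => rw [hδ j m m.2, augmentation_single]
    | add m m' h h' => rw [map_add, map_add, h, h']

/-- The coaction of a graded ring, sending an element to the sum of its homogeneous components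
marked by their degrees. -/
noncomputable def IsGrRing.coaction (hGr : IsGrRing 𝒜) : R →+* R[G] :=
  hGr.exists_coaction.choose

theorem IsGrRing.coaction_of_mem (hGr : IsGrRing 𝒜) {i : G} {r : R} (hr : r ∈ 𝒜 i) :
    hGr.coaction r = .single i r :=
  hGr.exists_coaction.choose_spec.1 i r hr

theorem IsGrRing.coeff_coaction_mem (hGr : IsGrRing 𝒜) (r : R) (i : G) :
    (hGr.coaction r).coeff i ∈ 𝒜 i :=
  hGr.exists_coaction.choose_spec.2.1 r i

theorem IsGrRing.augmentation_coaction (hGr : IsGrRing 𝒜) (r : R) :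
    augmentation R G (hGr.coaction r) = r :=
  hGr.exists_coaction.choose_spec.2.2 r

theorem IsGrRing.coaction_injective (hGr : IsGrRing 𝒜) : Function.Injective hGr.coaction :=
  Function.LeftInverse.injective hGr.augmentation_coaction

theorem IsGrRing.sum_coeff_coaction (hGr : IsGrRing 𝒜) (r : R) :
    ((hGr.coaction r).coeff.sum fun _ a ↦ a) = r := by
  rw [← augmentation_eq_sum, hGr.augmentation_coaction]

/-- An element lies in a homogeneous ideal only if all its components do. -/
theorem IsGrRing.coeff_coaction_mem_of_isHomIdeal (hGr : IsGrRing 𝒜) {I : Ideal R}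
    (hI : IsHomIdeal 𝒜 I) {r : R} (hr : r ∈ I) (i : G) : (hGr.coaction r).coeff i ∈ I := by
  have hr' := hI r hr
  clear hr
  induction hr' using AddSubmonoid.closure_induction with
  | mem x hx =>
    obtain ⟨⟨j, hj⟩, hxI⟩ := hx
    rw [hGr.coaction_of_mem hj]
    by_cases h : j = i
    · subst h; simpa using hxI
    · simp [h]
  | zero => simp
  | add x y _ _ hx hy => simpa using add_mem hx hy

end Coaction

theorem RingHom.exists_factor_of_range_le {X Y Z : Type*} [CommRing X] [CommRing Y] [CommRing Z]
    (f : X →+* Y) (g : Z →+* Y) (hg : Function.Injective g) (h : f.range ≤ g.range) :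
    ∃ k : X →+* Z, ∀ x, g (k x) = f x := by
  let e := RingEquiv.ofBijective g.rangeRestrict
    ⟨fun a b hab ↦ hg (congrArg Subtype.val hab), g.rangeRestrict_surjective⟩
  refine ⟨e.symm.toRingHom.comp (f.codRestrict g.range fun x ↦ h ⟨x, rfl⟩), fun x ↦ ?_⟩
  have := congrArg Subtype.val (e.apply_symm_apply (f.codRestrict g.range (fun x ↦ h ⟨x, rfl⟩) x))
  exact this

theorem AddMonoidAlgebra.mapRingHom_injective {A B : Type*} (G : Type*) [CommRing A] [CommRing B]
    [AddCommGroup G] {f : A →+* B} (hf : Function.Injective f) :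
    Function.Injective (mapRingHom G f) :=
  map_injective (f : A →+ B) hf

/-- The comultiplication `single g a ↦ single g (single g a)` of a group algebra. -/
noncomputable def AddMonoidAlgebra.comultiplication (A G : Type*) [CommRing A] [AddCommGroup G] :
    A[G] →+* A[G][G] :=
  liftNCRingHom (singleZeroRingHom.comp singleZeroRingHom)
    { toFun := fun g ↦ single g.toAdd (single g.toAdd 1)
      map_one' := rfl
      map_mul' := fun g h ↦ by simp } fun _ _ ↦ Commute.all _ _

@[simp]
theorem AddMonoidAlgebra.comultiplication_single {A G : Type*} [CommRing A] [AddCommGroup G]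
    (g : G) (a : A) : comultiplication A G (single g a) = single g (single g a) := by
  simp [comultiplication]

theorem AddMonoidAlgebra.coeff_comultiplication {A G : Type*} [CommRing A] [AddCommGroup G]
    (x : A[G]) (g : G) : (comultiplication A G x).coeff g = single g (x.coeff g) := by
  classical
  induction x using AddMonoidAlgebra.induction_linear with
  | zero => simp
  | add x y hx hy => simp [hx, hy]
  | single m r =>
    by_cases h : m = g
    · subst h; simp
    · simp [h]

/-- `R` embeds into `B` and every element of `B` is a fraction of elements of `R`. -/
def HasFractionsOver (R B : Type*) [CommRing R] [CommRing B] [Algebra R B] : Prop :=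
  Function.Injective (algebraMap R B) ∧
    ∀ b : B, ∃ r s : R, s ≠ 0 ∧ b * algebraMap R B s = algebraMap R B r

theorem Subalgebra.hasFractionsOver {R : Type*} [CommRing R] [IsDomain R]
    (B : Subalgebra R (FractionRing R)) : HasFractionsOver R B := by
  refine ⟨fun a b h ↦ IsFractionRing.injective R (FractionRing R) (congrArg Subtype.val h),
    fun b ↦ ?_⟩
  obtain ⟨⟨r, s⟩, h⟩ := IsLocalization.surj (nonZeroDivisors R) (b : FractionRing R)
  exact ⟨r, s, nonZeroDivisors.ne_zero s.2, Subtype.ext h⟩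

theorem HasFractionsOver.ringHom_ext {R B D : Type*} [CommRing R] [CommRing B] [Algebra R B]
    (hB : HasFractionsOver R B) [CommRing D] [IsDomain D] {f g : B →+* D}
    (hf : ∀ r, f (algebraMap R B r) = 0 → r = 0)
    (h : ∀ r, f (algebraMap R B r) = g (algebraMap R B r)) : f = g := by
  ext b
  obtain ⟨r, s, hs, hb⟩ := hB.2 b
  apply mul_right_cancel₀ (mt (hf s) hs)
  rw [← map_mul, hb, h, h, ← map_mul, hb]

/-- Multiplying by a homogeneous element shifts the homogeneous components. -/
theorem RingHom.coeff_mul_of_apply_eq_single {A G : Type*} [CommRing A] [AddCommGroup G]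
    {ψ : A →+* A[G]} {b : A} {d : G} (hb : ψ b = .single d b) (c : A) (g : G) :
    (ψ (b * c)).coeff g = b * (ψ c).coeff (g - d) := by
  rw [map_mul, hb]
  conv_lhs => rw [← add_sub_cancel d g]
  rw [AddMonoidAlgebra.coeff_single_mul_add]

section OverringCoaction

variable {G : Type*} [DecidableEq G] [AddCommGroup G] {R : Type*} [CommRing R]
  {𝒜 : G → AddSubgroup R} {B : Type*} [CommRing B] [Algebra R B]

/-- A ring homomorphism `B → B[G]` extends the coaction of `R`. -/
def IsGrRing.Extends (hGr : IsGrRing 𝒜) (ψ : B →+* B[G]) : Prop :=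
  ∀ r, ψ (algebraMap R B r) = AddMonoidAlgebra.mapRingHom G (algebraMap R B) (hGr.coaction r)

variable {hGr : IsGrRing 𝒜} {ψ : B →+* B[G]}

theorem IsGrRing.Extends.apply_of_mem (hψ : hGr.Extends ψ) {i : G} {r : R} (hr : r ∈ 𝒜 i) :
    ψ (algebraMap R B r) = .single i (algebraMap R B r) := by
  rw [hψ, hGr.coaction_of_mem hr, AddMonoidAlgebra.mapRingHom_single]

theorem IsGrRing.Extends.coeff_algebraMap (hψ : hGr.Extends ψ) (r : R) (i : G) :
    (ψ (algebraMap R B r)).coeff i = algebraMap R B ((hGr.coaction r).coeff i) := by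
  rw [hψ, AddMonoidAlgebra.coeff_mapRingHom]

theorem IsGrRing.Extends.augmentation_apply [IsDomain B] (hB : HasFractionsOver R B)
    (hψ : hGr.Extends ψ) (b : B) : augmentation B G (ψ b) = b := by
  have h : ∀ r, augmentation B G (ψ (algebraMap R B r)) = algebraMap R B r := fun r ↦ by
    rw [hψ, augmentation_mapRingHom, hGr.augmentation_coaction]
  exact congrArg (· b) (hB.ringHom_ext (f := (augmentation B G).comp ψ) (g := RingHom.id B)
    (fun r hr ↦ hB.1 (by rw [← h r, map_zero]; exact hr)) h)

theorem IsGrRing.Extends.sum_coeff [IsDomain B] (hB : HasFractionsOver R B)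
    (hψ : hGr.Extends ψ) (b : B) : ((ψ b).coeff.sum fun _ a ↦ a) = b := by
  rw [← augmentation_eq_sum, hψ.augmentation_apply hB]

theorem IsGrRing.Extends.injective [IsDomain B] (hB : HasFractionsOver R B)
    (hψ : hGr.Extends ψ) : Function.Injective ψ :=
  Function.LeftInverse.injective (hψ.augmentation_apply hB)

theorem IsGrRing.Extends.apply_coeff [IsDomain B] [IsAddTorsionFree G]
    (hB : HasFractionsOver R B) (hψ : hGr.Extends ψ) (b : B) (g : G) :
    ψ ((ψ b).coeff g) = .single g ((ψ b).coeff g) := by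
  have := uniqueSums_of_isAddTorsionFree G
  have hinj := hψ.injective hB
  have key : (AddMonoidAlgebra.mapRingHom G ψ).comp ψ =
      (AddMonoidAlgebra.comultiplication B G).comp ψ := by
    refine hB.ringHom_ext (fun r hr ↦ hB.1 (hinj ?_)) fun r ↦ ?_
    · apply AddMonoidAlgebra.mapRingHom_injective G hinj
      simpa using hr
    · rw [← hGr.sum_coeff_coaction r]
      simp only [Finsupp.sum, map_sum]
      refine Finset.sum_congr rfl fun i _ ↦ ?_
      have hi := hψ.apply_of_mem (hGr.coeff_coaction_mem r i)
      simp [hi]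
  have key' : AddMonoidAlgebra.mapRingHom G ψ (ψ b) =
      AddMonoidAlgebra.comultiplication B G (ψ b) := congrArg (· b) key
  rw [← AddMonoidAlgebra.coeff_comultiplication, ← key', AddMonoidAlgebra.coeff_mapRingHom]

end OverringCoaction

section HomFrac

variable {G : Type*} [DecidableEq G] [AddCommGroup G] [IsAddTorsionFree G]
  {R : Type*} [CommRing R] [IsDomain R] {𝒜 : G → AddSubgroup R} {hGr : IsGrRing 𝒜}
  {B : Subalgebra R (FractionRing R)} {ψ : B →+* B[G]}

theorem IsGrRing.Extends.exists_apply_eq_single (hψ : hGr.Extends ψ) {b : B}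
    (hb : IsHomFrac 𝒜 (b : FractionRing R)) : ∃ d, ψ b = .single d b := by
  have := uniqueSums_of_isAddTorsionFree G
  obtain ⟨i, j, u, v, hu, hv, hv0, h⟩ := hb
  have h' : b * algebraMap R B v = algebraMap R B u := Subtype.ext h
  have hv1 : ψ (algebraMap R B v) ≠ 0 := fun h0 ↦ hv0 <| B.hasFractionsOver.1 <|
    hψ.injective B.hasFractionsOver (by simpa using h0)
  refine ⟨i - j, mul_right_cancel₀ hv1 ?_⟩
  rw [← map_mul, h', hψ.apply_of_mem hu, hψ.apply_of_mem hv, AddMonoidAlgebra.single_mul_single,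
    h', sub_add_cancel]

omit [IsAddTorsionFree G] in
theorem IsGrRing.Extends.isHomFrac_of_apply_eq_single (hψ : hGr.Extends ψ) {b : B} {d : G}
    (hb : ψ b = .single d b) : IsHomFrac 𝒜 (b : FractionRing R) := by
  obtain ⟨r, s, hs, h⟩ := B.hasFractionsOver.2 b
  obtain ⟨j, hj⟩ : ∃ j, (hGr.coaction s).coeff j ≠ 0 := by
    by_contra! h0
    exact hs (hGr.coaction_injective (by ext; simp [h0]))
  refine ⟨d + j, j, _, _, hGr.coeff_coaction_mem r (d + j), hGr.coeff_coaction_mem s j, hj, ?_⟩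
  have := RingHom.coeff_mul_of_apply_eq_single hb (algebraMap R B s) (d + j)
  rw [h, hψ.coeff_algebraMap, hψ.coeff_algebraMap, add_sub_cancel_left] at this
  exact (congrArg Subtype.val this).symm

theorem IsGrRing.Extends.isHomFrac_coeff (hψ : hGr.Extends ψ) (b : B) (g : G) :
    IsHomFrac 𝒜 ((ψ b).coeff g : FractionRing R) :=
  hψ.isHomFrac_of_apply_eq_single (hψ.apply_coeff B.hasFractionsOver b g)

end HomFrac

section IntegralClosure

variable {G : Type*} [DecidableEq G] [AddCommGroup G] [IsAddTorsionFree G]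
  {R : Type*} [CommRing R] [IsDomain R] {𝒜 : G → AddSubgroup R}

omit [IsDomain R] in
theorem IsGrRing.exists_extends_of_isIntegrallyClosed (hGr : IsGrRing 𝒜) {C : Type*}
    [CommRing C] [IsDomain C] [IsIntegrallyClosed C] [Algebra R C] [Algebra.IsIntegral R C]
    (K : Type*) [Field K] [Algebra R K] [Algebra C K] [IsScalarTower R C K] [IsFractionRing R K]
    (hC : Function.Injective (algebraMap R C)) : ∃ ψ : C →+* C[G], hGr.Extends ψ := by
  have := uniqueSums_of_isAddTorsionFree G
  have : IsIntegrallyClosed C[G] := isIntegrallyClosed_addMonoidAlgebra C G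
  let L := FractionRing C[G]
  have hL : Function.Injective (algebraMap C[G] L) := IsFractionRing.injective _ _
  let j : R →+* L := (algebraMap C[G] L).comp
    ((AddMonoidAlgebra.mapRingHom G (algebraMap R C)).comp hGr.coaction)
  have hj : Function.Injective j := fun x y hxy ↦ hGr.coaction_injective
    (AddMonoidAlgebra.mapRingHom_injective G hC (hL hxy))
  let φ : C →+* L := (IsFractionRing.lift (K := K) hj).comp (algebraMap C K)
  have hφ : ∀ r, φ (algebraMap R C r) = j r := fun r ↦ by
    simp only [φ, RingHom.comp_apply, ← IsScalarTower.algebraMap_apply]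
    exact IsFractionRing.lift_algebraMap hj r
  have hrange : φ.range ≤ (algebraMap C[G] L).range := by
    rintro _ ⟨x, rfl⟩
    obtain ⟨p, hp, hpx⟩ := Algebra.IsIntegral.isIntegral (R := R) x
    refine (isIntegrallyClosed_iff L).1 ‹_› ⟨p.map
      ((AddMonoidAlgebra.mapRingHom G (algebraMap R C)).comp hGr.coaction), hp.map _, ?_⟩
    have hcomp : j = φ.comp (algebraMap R C) := RingHom.ext fun r ↦ (hφ r).symm
    rw [Polynomial.eval₂_map]
    change Polynomial.eval₂ j _ _ = 0
    rw [hcomp, ← Polynomial.hom_eval₂, hpx, map_zero]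
  obtain ⟨ψ, hψ⟩ := RingHom.exists_factor_of_range_le φ (algebraMap C[G] L) hL hrange
  exact ⟨ψ, fun r ↦ hL ((hψ _).trans (hφ r))⟩

theorem IsGrRing.exists_extends_integralClosure (hGr : IsGrRing 𝒜) :
    ∃ ψ : integralClosure R (FractionRing R) →+* (integralClosure R (FractionRing R))[G],
      hGr.Extends ψ :=
  have : IsIntegrallyClosed (integralClosure R (FractionRing R)) :=
    integralClosure.isIntegrallyClosedOfFiniteExtension (FractionRing R)
  hGr.exists_extends_of_isIntegrallyClosed (FractionRing R) (Subalgebra.hasFractionsOver _).1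

end IntegralClosure

universe u v w x

/-- A ring extension that is injective on spectra and has purely inseparable residue field
extensions is an epimorphism for homomorphisms into domains. -/
theorem RingHom.eq_of_purelyInsepResidue {A B D : Type*} [CommRing A] [CommRing B] [CommRing D]
    [IsDomain D] (i : A →+* B) (hi : Function.Injective (PrimeSpectrum.comap i))
    (hpi : ∀ (Q : Ideal B) (hQ : Q.IsPrime), PurelyInsepResidue i Q hQ) {f g : B →+* D}
    (h : f.comp i = g.comp i) : f = g := by
  let Ω := FractionRing D
  let f' := (algebraMap D Ω).comp f
  let g' := (algebraMap D Ω).comp g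
  have hΩ : Function.Injective (algebraMap D Ω) := IsFractionRing.injective _ _
  suffices hfg : f' = g' by
    ext b
    exact hΩ (congrArg (· b) hfg)
  have h' : f'.comp i = g'.comp i := by
    simp only [f', g', RingHom.comp_assoc, h]
  have hker : RingHom.ker f' = RingHom.ker g' := by
    have := @hi ⟨RingHom.ker f', RingHom.ker_isPrime f'⟩ ⟨RingHom.ker g', RingHom.ker_isPrime g'⟩
      (PrimeSpectrum.ext (by
        change (RingHom.ker f').comap i = (RingHom.ker g').comap i
        rw [RingHom.comap_ker, RingHom.comap_ker, h']))
    exact congrArg PrimeSpectrum.asIdeal this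
  let Q := RingHom.ker f'
  have hQ : Q.IsPrime := RingHom.ker_isPrime f'
  have : (Q.comap i).IsPrime := Ideal.IsPrime.comap i
  let F := Ideal.ResidueField.lift Q f' le_rfl fun x hx ↦ IsUnit.mk0 _ hx
  let F' := Ideal.ResidueField.lift Q g' hker.le fun x hx ↦ IsUnit.mk0 _ fun h0 ↦
    hx (hker.ge h0)
  have hF : ∀ x, F (algebraMap _ _ x) = f' x := fun x ↦
    Ideal.ResidueField.lift_algebraMap _ _ _ _ _
  have hF' : ∀ x, F' (algebraMap _ _ x) = g' x := fun x ↦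
    Ideal.ResidueField.lift_algebraMap _ _ _ _ _
  let : Algebra (Q.comap i).ResidueField Q.ResidueField :=
    (Ideal.ResidueField.map (Q.comap i) Q i rfl).toAlgebra
  have : IsPurelyInseparable (Q.comap i).ResidueField Q.ResidueField := hpi Q hQ
  have hFF : F = F' := by
    apply IsPurelyInseparable.injective_comp_algebraMap (Q.comap i).ResidueField Q.ResidueField Ω
    refine Ideal.ResidueField.ringHom_ext (RingHom.ext fun a ↦ ?_)
    change F (Ideal.ResidueField.map (Q.comap i) Q i rfl (algebraMap _ _ a)) =
      F' (Ideal.ResidueField.map (Q.comap i) Q i rfl (algebraMap _ _ a))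
    rw [Ideal.ResidueField.map_algebraMap, hF, hF']
    exact congrArg (· a) h'
  ext b
  rw [← hF, ← hF', hFF]

theorem Ideal.exists_isPrime_comap_eq_of_injective {R S : Type*} [CommRing R] [CommRing S]
    [Algebra R S] [Algebra.IsIntegral R S] (h : Function.Injective (algebraMap R S))
    (P : Ideal R) [P.IsPrime] : ∃ Q : Ideal S, Q.IsPrime ∧ Q.comap (algebraMap R S) = P := by
  obtain ⟨Q, -, hQ⟩ := Ideal.exists_ideal_over_prime_of_isIntegral P (⊥ : Ideal S) (by
    rw [← RingHom.ker_eq_comap_bot, (RingHom.injective_iff_ker_eq_bot _).1 h]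
    exact bot_le)
  exact ⟨Q, hQ⟩

/-- A homomorphism from `R` to an algebraically closed field whose kernel is the contraction of a
prime `Q` of an integral extension `C` extends to `C` with kernel `Q`. -/
theorem Ideal.exists_extension_ker_eq {R C Ω : Type*} [CommRing R] [CommRing C] [Algebra R C]
    [Algebra.IsIntegral R C] [Field Ω] [IsAlgClosed Ω] (Q : Ideal C) [Q.IsPrime] (i : R →+* Ω)
    (hi : RingHom.ker i = Q.under R) :
    ∃ f : C →+* Ω, f.comp (algebraMap R C) = i ∧ RingHom.ker f = Q := by
  let P := Q.under R
  let j : R ⧸ P →+* Ω := Ideal.Quotient.lift P i hi.ge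
  have hj : Function.Injective j := Ideal.injective_lift_iff hi.ge |>.2 hi
  let : Algebra (R ⧸ P) Ω := j.toAlgebra
  have : FaithfulSMul (R ⧸ P) Ω := (faithfulSMul_iff_algebraMap_injective _ _).2 hj
  have : Module.IsTorsionFree (R ⧸ P) (C ⧸ Q) :=
    Module.isTorsionFree_iff_faithfulSMul.2 inferInstance
  let φ : C ⧸ Q →ₐ[R ⧸ P] Ω := IsAlgClosed.lift
  have hφ : RingHom.ker φ.toRingHom = ⊥ := by
    apply Ideal.eq_bot_of_comap_eq_bot (R := R ⧸ P)
    rw [RingHom.comap_ker, ← RingHom.injective_iff_ker_eq_bot]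
    intro x y hxy
    exact hj (((φ.commutes x).symm.trans hxy).trans (φ.commutes y))
  refine ⟨φ.toRingHom.comp (Ideal.Quotient.mk Q), RingHom.ext fun r ↦ ?_, ?_⟩
  · exact φ.commutes (Ideal.Quotient.mk P r)
  · rw [← RingHom.comap_ker, hφ, ← RingHom.ker_eq_comap_bot, Ideal.mk_ker]

/-- The elements of an `R`-algebra `C` at which any two homomorphisms into a domain agree as soon
as they agree on `R`. -/
def weakSubintegralClosure (R : Type u) (C : Type v) [CommRing R] [CommRing C] [Algebra R C] :
    Subalgebra R C where
  carrier := {b | ∀ (D : Type w) [CommRing D] [IsDomain D] (f g : C →+* D),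
    f.comp (algebraMap R C) = g.comp (algebraMap R C) → f b = g b}
  mul_mem' ha hb D _ _ f g h := by rw [map_mul, map_mul, ha D f g h, hb D f g h]
  add_mem' ha hb D _ _ f g h := by rw [map_add, map_add, ha D f g h, hb D f g h]
  algebraMap_mem' r D _ _ f g h := congrArg (· r) h

theorem weakSubintegralClosure_comap_injective (R : Type u) (C : Type v) [CommRing R]
    [CommRing C] [Algebra R C] [Algebra.IsIntegral R C]
    (P₁ P₂ : Ideal (weakSubintegralClosure.{u, v, max u w} R C)) [P₁.IsPrime] [P₂.IsPrime]
    (h : P₁.comap (algebraMap R _) = P₂.comap (algebraMap R _)) : P₁ = P₂ := by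
  let B := weakSubintegralClosure.{u, v, max u w} R C
  have : Algebra.IsIntegral B C := Algebra.IsIntegral.tower_top (R := R)
  obtain ⟨Q₁, _, rfl⟩ :=
    Ideal.exists_isPrime_comap_eq_of_injective (S := C) Subtype.val_injective P₁
  obtain ⟨Q₂, _, rfl⟩ :=
    Ideal.exists_isPrime_comap_eq_of_injective (S := C) Subtype.val_injective P₂
  have h' : Q₁.under R = Q₂.under R := h
  let P := Q₁.under R
  let i : R →+* AlgebraicClosure P.ResidueField :=
    (algebraMap P.ResidueField _).comp (algebraMap R _)
  have hi : RingHom.ker i = P := by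
    ext r
    simp [i, RingHom.mem_ker]
  obtain ⟨f, hf, hfQ⟩ := Q₁.exists_extension_ker_eq i hi
  obtain ⟨g, hg, hgQ⟩ := Q₂.exists_extension_ker_eq i (hi.trans h')
  have hfg : ∀ b : B, f b = g b := fun b ↦ by
    let e : AlgebraicClosure P.ResidueField →+* ULift.{w} (AlgebraicClosure P.ResidueField) :=
      ULift.ringEquiv.symm.toRingHom
    have he : Function.Injective e := ULift.ringEquiv.symm.injective
    have : IsDomain (ULift.{w} (AlgebraicClosure P.ResidueField)) :=
      ULift.ringEquiv.toMulEquiv.isDomain _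
    exact he (b.2 _ (e.comp f) (e.comp g) (by rw [RingHom.comp_assoc, hf, RingHom.comp_assoc, hg]))
  ext b
  rw [Ideal.mem_comap, Ideal.mem_comap, ← hfQ, ← hgQ, RingHom.mem_ker, RingHom.mem_ker]
  exact (hfg b) ▸ Iff.rfl

section

variable {G : Type v} [DecidableEq G] [AddCommGroup G] {R : Type u} [CommRing R]
  {𝒜 : G → AddSubgroup R} {hGr : IsGrRing 𝒜} {C : Type x} [CommRing C] [Algebra R C]

theorem IsGrRing.Extends.exists_restrict {ψ : C →+* C[G]} (hψ : hGr.Extends ψ)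
    (B : Subalgebra R C) (hB : ∀ b ∈ B, ∀ g, (ψ b).coeff g ∈ B) :
    ∃ ψ' : B →+* B[G], hGr.Extends ψ' := by
  have hinj := AddMonoidAlgebra.mapRingHom_injective G (f := B.val.toRingHom)
    Subtype.val_injective
  obtain ⟨ψ', h⟩ := RingHom.exists_factor_of_range_le (ψ.comp B.val.toRingHom)
    (AddMonoidAlgebra.mapRingHom G B.val.toRingHom) hinj (by
      rintro _ ⟨b, rfl⟩
      have : ψ b ∈ Set.range (AddMonoidAlgebra.map (M := G) (B.val.toRingHom : B →+ C)) := by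
        rw [AddMonoidAlgebra.range_map]
        exact fun g ↦ ⟨⟨_, hB b b.2 g⟩, rfl⟩
      exact this)
  refine ⟨ψ', fun r ↦ hinj ?_⟩
  rw [h]
  ext g
  simp only [AddMonoidAlgebra.coeff_mapRingHom]
  exact hψ.coeff_algebraMap r g

theorem IsGrRing.Extends.congr {D : Type*} [CommRing D] [Algebra R D] {ψ : C →+* C[G]}
    (hψ : hGr.Extends ψ) (e : C ≃ₐ[R] D) : ∃ ψ' : D →+* D[G], hGr.Extends ψ' := by
  refine ⟨((AddMonoidAlgebra.mapRingHom G (e : C →+* D)).comp ψ).comp (e.symm : D →+* C),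
    fun r ↦ ?_⟩
  ext g
  simp [hψ.coeff_algebraMap]

theorem IsGrRing.Extends.exists_weakSubintegralClosure [IsAddTorsionFree G] {ψ : C →+* C[G]}
    (hψ : hGr.Extends ψ) :
    ∃ ψ' : weakSubintegralClosure.{u, x, max u v} R C →+*
      (weakSubintegralClosure.{u, x, max u v} R C)[G], hGr.Extends ψ' := by
  refine hψ.exists_restrict _ fun b hb γ D _ _ f g h ↦ ?_
  have := uniqueSums_of_isAddTorsionFree G
  have key := hb D[G] ((AddMonoidAlgebra.mapRingHom G f).comp ψ)
    ((AddMonoidAlgebra.mapRingHom G g).comp ψ) (RingHom.ext fun r ↦ by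
      ext γ
      simpa [hψ.coeff_algebraMap] using congrArg (· ((hGr.coaction r).coeff γ)) h)
  simpa using congrArg (fun z ↦ z.coeff γ) key

end

section GradedCore

variable {G : Type*} [AddCommGroup G] {A : Type*} [CommRing A]

/-- The elements all of whose components, with respect to `ψ`, lie in the ideal `N`. -/
noncomputable def gradedCore (ψ : A →+* A[G]) (N : Ideal A) : Ideal A :=
  RingHom.ker ((AddMonoidAlgebra.mapRingHom G (Ideal.Quotient.mk N)).comp ψ)

theorem mem_gradedCore {ψ : A →+* A[G]} {N : Ideal A} {a : A} :
    a ∈ gradedCore ψ N ↔ ∀ g, (ψ a).coeff g ∈ N := by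
  simp only [gradedCore, RingHom.mem_ker, RingHom.comp_apply, AddMonoidAlgebra.ext_iff,
    Finsupp.ext_iff, AddMonoidAlgebra.coeff_mapRingHom, Ideal.Quotient.eq_zero_iff_mem,
    AddMonoidAlgebra.coeff_zero, Finsupp.zero_apply]

theorem gradedCore_isPrime [IsAddTorsionFree G] (ψ : A →+* A[G]) (N : Ideal A) [N.IsPrime] :
    (gradedCore ψ N).IsPrime :=
  have := uniqueSums_of_isAddTorsionFree G
  RingHom.ker_isPrime _

end GradedCore

section HomogeneousPrimes

variable {G : Type*} [DecidableEq G] [AddCommGroup G] {R : Type*} [CommRing R]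
  {𝒜 : G → AddSubgroup R}

theorem IsGrRing.isHomIdeal_gradedCore (hGr : IsGrRing 𝒜) (m : Ideal R) :
    IsHomIdeal 𝒜 (gradedCore hGr.coaction m) := by
  intro r hr
  rw [← hGr.sum_coeff_coaction r]
  refine sum_mem fun i _ ↦ AddSubmonoid.subset_closure ⟨⟨i, hGr.coeff_coaction_mem r i⟩, ?_⟩
  refine mem_gradedCore.2 fun j ↦ ?_
  rw [hGr.coaction_of_mem (hGr.coeff_coaction_mem r i)]
  by_cases h : i = j
  · subst h; simpa using mem_gradedCore.1 hr i
  · simp [h]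

theorem IsGrRing.exists_coeff_coaction_notMem (hGr : IsGrRing 𝒜) {I : Ideal R} {r : R}
    (hr : r ∉ I) : ∃ i, (hGr.coaction r).coeff i ∉ I := by
  by_contra! h
  exact hr (hGr.sum_coeff_coaction r ▸ sum_mem fun i _ ↦ h i)

/-- In an extension that is injective on spectra, the primes over homogeneous primes contain the
components of their elements. -/
theorem IsGrRing.Extends.coeff_mem {hGr : IsGrRing 𝒜} [IsAddTorsionFree G] {B : Type*}
    [CommRing B] [IsDomain B] [Algebra R B] {ψ : B →+* B[G]} (hψ : hGr.Extends ψ)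
    (hB : HasFractionsOver R B)
    (hinj : ∀ N N' : Ideal B, N.IsPrime → N'.IsPrime →
      N.comap (algebraMap R B) = N'.comap (algebraMap R B) → N = N')
    {N : Ideal B} (hN : N.IsPrime) (hhom : IsHomIdeal 𝒜 (N.comap (algebraMap R B)))
    {b : B} (hb : b ∈ N) (g : G) : (ψ b).coeff g ∈ N := by
  have hcore : gradedCore ψ N = N := by
    refine hinj _ _ (gradedCore_isPrime ψ N) hN (le_antisymm (Ideal.comap_mono fun c hc ↦ ?_)
      fun r hr ↦ Ideal.mem_comap.2 (mem_gradedCore.2 fun i ↦ ?_))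
    · rw [← hψ.sum_coeff hB c, Finsupp.sum]
      exact N.sum_mem fun i _ ↦ mem_gradedCore.1 hc i
    · rw [hψ.coeff_algebraMap]
      exact hGr.coeff_coaction_mem_of_isHomIdeal hhom hr i
  exact mem_gradedCore.1 (hcore.ge hb) g

/-- The homogeneous elements outside a prime ideal. -/
def IsGrRing.homCompl (hGr : IsGrRing 𝒜) (M : Ideal R) [hM : M.IsPrime] : Submonoid R where
  carrier := {w | SetLike.IsHomogeneousElem 𝒜 w ∧ w ∉ M}
  one_mem' := ⟨⟨0, hGr.one_mem⟩, fun h ↦ hM.ne_top ((Ideal.eq_top_iff_one M).2 h)⟩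
  mul_mem' := by
    rintro a b ⟨⟨i, hi⟩, ha⟩ ⟨⟨j, hj⟩, hb⟩
    exact ⟨⟨i + j, hGr.mul_mem hi hj⟩, fun h ↦ (hM.mem_or_mem h).elim ha hb⟩

end HomogeneousPrimes

namespace Subalgebra

variable {R : Type*} [CommRing R] {K : Type*} [Field K] [Algebra R K]

/-- The localization of an intermediate ring `B` at a multiplicative subset of `R`. -/
def localizationAt (B : Subalgebra R K) (W : Submonoid R) : Subalgebra R K where
  carrier := {x | ∃ w ∈ W, algebraMap R K w * x ∈ B}
  mul_mem' := by
    rintro x y ⟨w, hw, hx⟩ ⟨v, hv, hy⟩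
    refine ⟨w * v, mul_mem hw hv, ?_⟩
    have := mul_mem hx hy
    rwa [mul_mul_mul_comm, ← map_mul] at this
  add_mem' := by
    rintro x y ⟨w, hw, hx⟩ ⟨v, hv, hy⟩
    refine ⟨w * v, mul_mem hw hv, ?_⟩
    have := add_mem (mul_mem (B.algebraMap_mem v) hx) (mul_mem (B.algebraMap_mem w) hy)
    convert this using 1
    rw [map_mul]
    ring
  algebraMap_mem' r := ⟨1, one_mem W, mul_mem (B.algebraMap_mem 1) (B.algebraMap_mem r)⟩

variable {B : Subalgebra R K} {W : Submonoid R}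

theorem le_localizationAt : B ≤ B.localizationAt W :=
  fun _ hx ↦ ⟨1, one_mem W, mul_mem (B.algebraMap_mem 1) hx⟩

theorem isUnit_algebraMap_localizationAt {w : R} (hw : w ∈ W) (h0 : algebraMap R K w ≠ 0) :
    IsUnit (algebraMap R (B.localizationAt W) w) := by
  refine IsUnit.of_mul_eq_one (⟨(algebraMap R K w)⁻¹, w, hw, ?_⟩ : B.localizationAt W)
    (Subtype.ext (mul_inv_cancel₀ h0))
  rw [mul_inv_cancel₀ h0]
  exact one_mem B

/-- The extension of an ideal of `B` to the localization of `B`. -/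
def extendIdeal (W : Submonoid R) (N : Ideal B) : Ideal (B.localizationAt W) where
  carrier := {s | ∃ w ∈ W, ∃ n ∈ N, algebraMap R K w * s = n}
  zero_mem' := ⟨1, one_mem W, 0, zero_mem N, by simp⟩
  add_mem' := by
    rintro x y ⟨w, hw, n, hn, hx⟩ ⟨v, hv, n', hn', hy⟩
    refine ⟨w * v, mul_mem hw hv, algebraMap R B v * n + algebraMap R B w * n',
      add_mem (N.mul_mem_left _ hn) (N.mul_mem_left _ hn'), ?_⟩
    change _ = algebraMap R K v * n + algebraMap R K w * n'
    rw [← hx, ← hy, map_mul]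
    push_cast
    ring
  smul_mem' := by
    rintro ⟨c, v, hv, hc⟩ x ⟨w, hw, n, hn, hx⟩
    refine ⟨v * w, mul_mem hv hw, ⟨_, hc⟩ * n, N.mul_mem_left _ hn, ?_⟩
    change _ = algebraMap R K v * c * n
    rw [← hx, map_mul]
    change _ * (c * (x : K)) = _
    ring

variable {N : Ideal B} [hN : N.IsPrime] (hW : ∀ w ∈ W, algebraMap R B w ∉ N)
include hW

theorem mem_of_mem_extendIdeal {s : B.localizationAt W} (hs : s ∈ extendIdeal W N) {w : R}
    {b : B} (hb : algebraMap R K w * s = b) : b ∈ N := by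
  obtain ⟨v, hv, n, hn, h⟩ := hs
  have : algebraMap R B v * b = algebraMap R B w * n := Subtype.ext <| by
    change algebraMap R K v * b = algebraMap R K w * n
    rw [← h, ← hb]
    ring
  exact (hN.mem_or_mem (this ▸ N.mul_mem_left _ hn)).resolve_left (hW v hv)

theorem extendIdeal_isPrime : (extendIdeal W N).IsPrime := by
  refine ⟨fun h ↦ ?_, fun {x y} hxy ↦ ?_⟩
  · have h1 : (1 : B.localizationAt W) ∈ extendIdeal W N := h ▸ Submodule.mem_top
    refine hN.ne_top ((Ideal.eq_top_iff_one N).2 (mem_of_mem_extendIdeal hW h1 (w := 1) ?_))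
    simp
  · obtain ⟨w, hw, hx⟩ := x.2
    obtain ⟨v, hv, hy⟩ := y.2
    have := mem_of_mem_extendIdeal hW hxy (w := w * v) (b := ⟨_, hx⟩ * ⟨_, hy⟩) (by
      rw [map_mul]
      push_cast
      ring)
    exact (hN.mem_or_mem this).imp (fun h ↦ ⟨w, hw, _, h, rfl⟩) fun h ↦ ⟨v, hv, _, h, rfl⟩

theorem comap_algebraMap_extendIdeal :
    (extendIdeal W N).comap (algebraMap R (B.localizationAt W)) =
      N.comap (algebraMap R B) := by
  refine le_antisymm (fun r hr ↦ ?_) fun r hr ↦ ⟨1, one_mem W, _, hr, ?_⟩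
  · refine mem_of_mem_extendIdeal hW hr (w := 1) ?_
    rw [map_one, one_mul]
    rfl
  · rw [map_one, one_mul]
    rfl

end Subalgebra

section GradedLocalization

variable {G : Type*} [DecidableEq G] [AddCommGroup G] [IsAddTorsionFree G]
  {R : Type*} [CommRing R] [IsDomain R] {𝒜 : G → AddSubgroup R} {hGr : IsGrRing 𝒜}

omit [IsAddTorsionFree G] in
theorem IsGrRing.isHomFrac_of_algebraMap_mul (hGr : IsGrRing 𝒜) {w : R} {x y : FractionRing R}
    (hw : SetLike.IsHomogeneousElem 𝒜 w) (hw0 : w ≠ 0) (hx : IsHomFrac 𝒜 x)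
    (h : algebraMap R (FractionRing R) w * y = x) : IsHomFrac 𝒜 y := by
  obtain ⟨k, hk⟩ := hw
  obtain ⟨i, j, a, b, ha, hb, hb0, hab⟩ := hx
  refine ⟨i, k + j, a, w * b, ha, hGr.mul_mem hk hb, mul_ne_zero hw0 hb0, ?_⟩
  rw [← hab, ← h, map_mul]
  ring

omit [IsAddTorsionFree G] [IsDomain R] in
theorem IsGrRing.isHomFrac_algebraMap_mul (hGr : IsGrRing 𝒜) {w : R} {x : FractionRing R}
    (hw : SetLike.IsHomogeneousElem 𝒜 w) (hx : IsHomFrac 𝒜 x) :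
    IsHomFrac 𝒜 (algebraMap R (FractionRing R) w * x) := by
  obtain ⟨k, hk⟩ := hw
  obtain ⟨i, j, a, b, ha, hb, hb0, hab⟩ := hx
  refine ⟨k + i, j, w * a, b, hGr.mul_mem hk ha, hb, hb0, ?_⟩
  rw [mul_assoc, hab, map_mul]

variable {B : Subalgebra R (FractionRing R)} {ψ : B →+* B[G]}

/-- A fraction with numerator in `B` and homogeneous denominator is the sum of the fractions of
the components of the numerator. -/
theorem IsGrRing.Extends.mem_closure_of_algebraMap_mul (hψ : hGr.Extends ψ) {w : R}
    {x : FractionRing R} {b : B} (hw : SetLike.IsHomogeneousElem 𝒜 w) (hw0 : w ≠ 0)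
    (h : algebraMap R (FractionRing R) w * x = b) {s : Set (FractionRing R)}
    (hs : ∀ y g, IsHomFrac 𝒜 y → algebraMap R (FractionRing R) w * y = (ψ b).coeff g → y ∈ s) :
    x ∈ AddSubmonoid.closure s := by
  have hw1 : algebraMap R (FractionRing R) w ≠ 0 :=
    (map_ne_zero_iff _ (IsFractionRing.injective R (FractionRing R))).2 hw0
  have hsum : x = ∑ g ∈ (ψ b).coeff.support,
      (algebraMap R (FractionRing R) w)⁻¹ * ((ψ b).coeff g : FractionRing R) := by
    rw [← Finset.mul_sum, ← AddSubmonoidClass.coe_finsetSum,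
      show ∑ g ∈ (ψ b).coeff.support, (ψ b).coeff g = b from hψ.sum_coeff B.hasFractionsOver b,
      ← h, inv_mul_cancel_left₀ hw1]
  rw [hsum]
  refine sum_mem fun g _ ↦ AddSubmonoid.subset_closure ?_
  have hg := mul_inv_cancel_left₀ hw1 ((ψ b).coeff g : FractionRing R)
  exact hs _ g (hGr.isHomFrac_of_algebraMap_mul hw hw0 (hψ.isHomFrac_coeff b g) hg) hg

variable {M : Ideal R} [hM : M.IsPrime]

omit [IsAddTorsionFree G] [IsDomain R] in
theorem IsGrRing.ne_zero_of_mem_homCompl {w : R} (hw : w ∈ hGr.homCompl M) : w ≠ 0 := by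
  rintro rfl
  exact hw.2 (zero_mem M)

omit [IsAddTorsionFree G] in
theorem IsGrRing.isUnit_of_mem_homCompl {w : R} (hw : w ∈ hGr.homCompl M) :
    IsUnit (algebraMap R (B.localizationAt (hGr.homCompl M)) w) :=
  Subalgebra.isUnit_algebraMap_localizationAt hw <|
    (map_ne_zero_iff _ (IsFractionRing.injective R (FractionRing R))).2
      (hGr.ne_zero_of_mem_homCompl hw)

theorem IsGrRing.Extends.isGradedOverring_localizationAt (hψ : hGr.Extends ψ) :
    IsGradedOverring 𝒜 (B.localizationAt (hGr.homCompl M)) := by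
  rintro x ⟨w, hw, hx⟩
  exact hψ.mem_closure_of_algebraMap_mul (b := ⟨_, hx⟩) hw.1 (hGr.ne_zero_of_mem_homCompl hw) rfl
    fun y g hy hyg ↦ ⟨⟨w, hw, hyg ▸ Subtype.prop _⟩, hy⟩

theorem IsGrRing.Extends.isHomIdealOver_extendIdeal (hψ : hGr.Extends ψ) {N : Ideal B}
    (hN : ∀ b ∈ N, ∀ g, (ψ b).coeff g ∈ N) :
    IsHomIdealOver 𝒜 (B.localizationAt (hGr.homCompl M))
      (Subalgebra.extendIdeal (hGr.homCompl M) N) := by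
  rintro x ⟨w, hw, n, hn, hx⟩
  exact hψ.mem_closure_of_algebraMap_mul hw.1 (hGr.ne_zero_of_mem_homCompl hw) hx
    fun y g hy hyg ↦ ⟨hy, ⟨w, hw, hyg ▸ Subtype.prop _⟩, w, hw, _, hN n hn g, hyg⟩

omit [IsAddTorsionFree G] [IsDomain R] in
theorem IsGrRing.notMem_of_mem_homCompl {N : Ideal B} (hNM : N.comap (algebraMap R B) = M) :
    ∀ w ∈ hGr.homCompl M, algebraMap R B w ∉ N :=
  fun _ hw h ↦ hw.2 (hNM ▸ Ideal.mem_comap.2 h)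

variable [Algebra.IsIntegral R B]
  (hinj : ∀ N N' : Ideal B, N.IsPrime → N'.IsPrime →
    N.comap (algebraMap R B) = N'.comap (algebraMap R B) → N = N')
include hinj

theorem IsGrRing.Extends.le_extendIdeal (hψ : hGr.Extends ψ) {N : Ideal B} (hN : N.IsPrime)
    (hNM : N.comap (algebraMap R B) = M) {J : Ideal (B.localizationAt (hGr.homCompl M))}
    (hJ : IsHomIdealOver 𝒜 _ J) (hJ' : J ≠ ⊤) :
    J ≤ Subalgebra.extendIdeal (hGr.homCompl M) N := by
  have key : ∀ y ∈ J, IsHomFrac 𝒜 (y : FractionRing R) →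
      y ∈ Subalgebra.extendIdeal (hGr.homCompl M) N := by
    intro y hyJ hy
    obtain ⟨w, hw, hwy⟩ := y.2
    let b : B := ⟨_, hwy⟩
    by_contra hyN
    have hbN : b ∉ N := fun h ↦ hyN ⟨w, hw, b, h, rfl⟩
    obtain ⟨d, hd⟩ := hψ.exists_apply_eq_single (b := b) (hGr.isHomFrac_algebraMap_mul hw.1 hy)
    have hspan : ¬ (Ideal.span {b}).comap (algebraMap R B) ≤ M := by
      intro hle
      obtain ⟨Q, hbQ, hQ, hQM⟩ := Ideal.exists_ideal_over_prime_of_isIntegral M _ hle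
      obtain rfl := hinj Q N hQ hN (hQM.trans hNM.symm)
      exact hbN (hbQ (Ideal.mem_span_singleton_self b))
    obtain ⟨r, hr, hrM⟩ := SetLike.not_le_iff_exists.1 hspan
    obtain ⟨c, hc⟩ := Ideal.mem_span_singleton'.1 hr
    obtain ⟨g, hg⟩ := hGr.exists_coeff_coaction_notMem hrM
    have hgW : (hGr.coaction r).coeff g ∈ hGr.homCompl M :=
      ⟨⟨g, hGr.coeff_coaction_mem r g⟩, hg⟩
    have hcomp := RingHom.coeff_mul_of_apply_eq_single hd c g
    rw [mul_comm, hc, hψ.coeff_algebraMap] at hcomp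
    refine hJ' (J.eq_top_of_isUnit_mem ?_ (hGr.isUnit_of_mem_homCompl (B := B) hgW))
    have : algebraMap R (B.localizationAt (hGr.homCompl M)) ((hGr.coaction r).coeff g) =
        algebraMap R _ w * ⟨_, Subalgebra.le_localizationAt ((ψ c).coeff (g - d)).2⟩ * y := by
      apply Subtype.ext
      refine (congrArg Subtype.val hcomp).trans ?_
      change algebraMap R (FractionRing R) w * y * _ = algebraMap R (FractionRing R) w * _ * y
      ring
    rw [this]
    exact J.mul_mem_left _ hyJ
  intro x hx
  have hx' : (x : FractionRing R) ∈ ((Subalgebra.extendIdeal (hGr.homCompl M) N).toAddSubmonoid.map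
      (B.localizationAt (hGr.homCompl M)).val) :=
    AddSubmonoid.closure_le.2 (by
      rintro y ⟨hy, hyS, hyJ⟩
      exact ⟨⟨y, hyS⟩, key _ hyJ hy, rfl⟩) (hJ x hx)
  obtain ⟨x', hx'N, hxx'⟩ := hx'
  obtain rfl : x' = x := Subtype.ext hxx'
  exact hx'N

theorem IsGrRing.Extends.grLocalOver_localizationAt (hψ : hGr.Extends ψ) (hMhom : IsHomIdeal 𝒜 M) :
    GrLocalOver 𝒜 (B.localizationAt (hGr.homCompl M)) := by
  obtain ⟨N, hN, hNM⟩ :=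
    Ideal.exists_isPrime_comap_eq_of_injective B.hasFractionsOver.1 M
  have hhom := hψ.isHomIdealOver_extendIdeal (M := M) fun b hb ↦
    hψ.coeff_mem B.hasFractionsOver hinj hN (hNM ▸ hMhom) hb
  have hle := fun J ↦ hψ.le_extendIdeal hinj hN hNM (J := J)
  have hprime := Subalgebra.extendIdeal_isPrime (hGr.notMem_of_mem_homCompl hNM)
  refine ⟨_, ⟨hhom, hprime.ne_top, fun J hJ hle' hJ' ↦ le_antisymm (hle J hJ hJ') hle'⟩,
    fun J hJ ↦ (hJ.2.2 _ hhom (hle J hJ.1 hJ.2.1) hprime.ne_top).symm⟩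

theorem IsGrRing.Extends.gGD_localizationAt (hψ : hGr.Extends ψ) :
    GGD 𝒜 (B.localizationAt (hGr.homCompl M)) := by
  intro P Q Qt hP hQ hQt hPhom _ _ hPQ hQtQ
  obtain ⟨N, hN, hNP⟩ :=
    Ideal.exists_isPrime_comap_eq_of_injective B.hasFractionsOver.1 P
  have hWQ : ∀ w ∈ hGr.homCompl M, w ∉ Q := fun w hw h ↦
    hQt.ne_top (Qt.eq_top_of_isUnit_mem (Ideal.mem_comap.1 (hQtQ ▸ h))
      (hGr.isUnit_of_mem_homCompl hw))
  have hWN : ∀ w ∈ hGr.homCompl M, algebraMap R B w ∉ N := fun w hw h ↦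
    hWQ w hw (hPQ (hNP ▸ Ideal.mem_comap.2 h))
  refine ⟨Subalgebra.extendIdeal (hGr.homCompl M) N, Subalgebra.extendIdeal_isPrime hWN,
    hψ.isHomIdealOver_extendIdeal fun b hb ↦
      hψ.coeff_mem B.hasFractionsOver hinj hN (hNP ▸ hPhom) hb, ?_,
    (Subalgebra.comap_algebraMap_extendIdeal hWN).trans hNP⟩
  obtain ⟨N', hNN', hN', hN'Q⟩ :=
    Ideal.exists_ideal_over_prime_of_isIntegral Q N (hNP.le.trans hPQ)
  let ι := (Subalgebra.inclusion
    (Subalgebra.le_localizationAt (B := B) (W := hGr.homCompl M))).toRingHom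
  obtain rfl : N' = Qt.comap ι := hinj _ _ hN' (hQt.comap ι) (hN'Q.trans hQtQ.symm)
  rintro s ⟨w, hw, n, hn, hs⟩
  have hmem : algebraMap R _ w * s ∈ Qt := by
    have : algebraMap R _ w * s = ι n := Subtype.ext hs
    rw [this]
    exact hNN' hn
  exact (hQt.mem_or_mem hmem).resolve_left fun h ↦
    hWQ w hw (hQtQ ▸ Ideal.mem_comap.2 h)

/-- An integral overring of a graded perinormal domain that carries an extension of the coaction
and is injective on spectra is trivial. -/
theorem IsGrRing.Extends.eq_bot_of_gradedPerinormal (hψ : hGr.Extends ψ)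
    (hperi : GradedPerinormal 𝒜) : B = ⊥ := by
  suffices hhom : ∀ b : B, IsHomFrac 𝒜 (b : FractionRing R) →
      (b : FractionRing R) ∈ (⊥ : Subalgebra R (FractionRing R)) by
    refine eq_bot_iff.2 fun x hx ↦ ?_
    have hsum := congrArg Subtype.val (hψ.sum_coeff B.hasFractionsOver ⟨x, hx⟩)
    rw [Finsupp.sum, AddSubmonoidClass.coe_finsetSum] at hsum
    change _ = x at hsum
    rw [← hsum]
    exact sum_mem fun g _ ↦ hhom _ (hψ.isHomFrac_coeff _ g)
  intro b hb
  obtain ⟨d, hd⟩ := hψ.exists_apply_eq_single hb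
  let I : Ideal R := (Subalgebra.toSubmodule (⊥ : Subalgebra R (FractionRing R))).comap
    (LinearMap.toSpanSingleton R (FractionRing R) b)
  have hI : ∀ {r : R}, r ∈ I ↔ r • (b : FractionRing R) ∈ (⊥ : Subalgebra R (FractionRing R)) :=
    Iff.rfl
  by_contra hbot
  have hItop : I ≠ ⊤ := fun h ↦ hbot (by simpa using hI.1 ((Ideal.eq_top_iff_one I).1 h))
  obtain ⟨m, hm, hIm⟩ := I.exists_le_maximal hItop
  have := hm.isPrime
  let M := gradedCore hGr.coaction m
  have hM : M.IsPrime := gradedCore_isPrime _ m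
  obtain ⟨W, hW, hloc⟩ := hperi (B.localizationAt (hGr.homCompl M))
    hψ.isGradedOverring_localizationAt
    (hψ.grLocalOver_localizationAt hinj (hGr.isHomIdeal_gradedCore m))
    (hψ.gGD_localizationAt hinj)
  obtain ⟨r, w, hw, hrw⟩ := hloc ⟨b, Subalgebra.le_localizationAt b.2⟩
  have hrw' : b * algebraMap R B w = algebraMap R B r := by
    apply Subtype.ext
    have := congrArg Subtype.val hrw
    exact this
  have hwM : w ∉ M := by
    intro hwM
    obtain ⟨s, hs⟩ := (hW w hw).exists_right_inv
    obtain ⟨v, hv, hvs⟩ := s.2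
    obtain ⟨N, hN, hNM⟩ :=
    Ideal.exists_isPrime_comap_eq_of_injective B.hasFractionsOver.1 M
    have hvw : algebraMap R B w * ⟨_, hvs⟩ = algebraMap R B v := Subtype.ext <| by
      have hs' : algebraMap R (FractionRing R) w * s = 1 := congrArg Subtype.val hs
      change algebraMap R (FractionRing R) w * (algebraMap R _ v * s) = algebraMap R _ v
      rw [mul_left_comm, hs', mul_one]
    refine hGr.notMem_of_mem_homCompl hNM v hv (hvw ▸ N.mul_mem_right _ ?_)
    exact Ideal.mem_comap.1 (hNM ▸ hwM)
  obtain ⟨g, hg⟩ : ∃ g, (hGr.coaction w).coeff g ∉ m := by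
    by_contra! h
    exact hwM (mem_gradedCore.2 h)
  refine hg (hIm (hI.2 ?_))
  have hcomp := RingHom.coeff_mul_of_apply_eq_single hd (algebraMap R B w) (d + g)
  rw [hrw', hψ.coeff_algebraMap, hψ.coeff_algebraMap, add_sub_cancel_left] at hcomp
  rw [Algebra.smul_def, mul_comm]
  have hmem : (b : FractionRing R) * algebraMap R (FractionRing R) ((hGr.coaction w).coeff g) =
      algebraMap R (FractionRing R) ((hGr.coaction r).coeff (d + g)) :=
    (congrArg Subtype.val hcomp).symm
  rw [hmem]
  exact Subalgebra.algebraMap_mem _ _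

end GradedLocalization

/-- Let `R` be a `G`-graded domain. If `R` is a graded perinormal domain,
then `R` is weakly normal. -/
theorem weaklyNormal_of_gradedPerinormal
    {G : Type*} [DecidableEq G] [AddCommGroup G] (hG : ∀ g : G, g ≠ 0 → ¬IsOfFinAddOrder g)
    {R : Type*} [CommRing R] [IsDomain R]
    (𝒜 : G → AddSubgroup R) (hGr : IsGrRing 𝒜)
    (hperi : GradedPerinormal 𝒜) :
    WeaklyNormal R := by
  intro T hT hspec hpi
  have : IsAddTorsionFree G := isAddTorsionFree_iff_not_isOfFinAddOrder.2 fun g ↦ hG g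
  let C := integralClosure R (FractionRing R)
  obtain ⟨ψ, hψ⟩ := hGr.exists_extends_integralClosure
  obtain ⟨ψ', hψ'⟩ := hψ.exists_weakSubintegralClosure
  let e := Subalgebra.equivMapOfInjective (weakSubintegralClosure R C) C.val
    Subtype.val_injective
  obtain ⟨χ, hχ⟩ := hψ'.congr e
  have : Algebra.IsIntegral R ((weakSubintegralClosure R C).map C.val) := ⟨fun b ↦ by
    obtain ⟨b, c, -, rfl⟩ := b
    exact (isIntegral_algHom_iff (Subalgebra.val _) Subtype.val_injective).1 c.2⟩
  have hbot := hχ.eq_bot_of_gradedPerinormal (fun N N' _ _ h ↦ by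
    apply Ideal.comap_injective_of_surjective e.toRingHom e.surjective
    apply weakSubintegralClosure_comap_injective
    rw [Ideal.comap_comap, Ideal.comap_comap]
    have : e.toRingHom.comp (algebraMap R _) = algebraMap R _ := RingHom.ext e.commutes
    rw [this, h]) hperi
  refine eq_bot_iff.2 (hbot ▸ fun t ht ↦ ?_)
  have hTC : T ≤ C := fun t ht ↦ (hT ⟨t, ht⟩).map T.val
  refine ⟨⟨t, hTC ht⟩, fun D _ _ f g h ↦ ?_, rfl⟩
  let i := (Subalgebra.inclusion hTC).toRingHom
  have hfg : f.comp i = g.comp i :=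
    RingHom.eq_of_purelyInsepResidue (algebraMap R T) hspec.1 hpi h
  exact congrArg (· ⟨t, ht⟩) hfg
end

section
/- Let R be a G-graded domain. If R is a graded perinormal domain, then R is a gr-(R₁) domain. -/
/-- Every prime ideal of a domain is the center of a valuation ring of its fraction field. -/
lemma exists_valuationSubring_center_eq {R : Type*} [CommRing R] [IsDomain R]
    (P : Ideal R) [P.IsPrime] :
    ∃ B : ValuationSubring (FractionRing R), (∀ r : R, algebraMap R (FractionRing R) r ∈ B) ∧
      ∀ r : R, algebraMap R (FractionRing R) r ∈ B.nonunits ↔ r ∈ P := by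
  have hu : ∀ y : P.primeCompl, IsUnit (algebraMap R (FractionRing R) y) := fun y ↦ by
    rw [isUnit_iff_ne_zero, Ne, FaithfulSMul.algebraMap_eq_zero_iff]
    intro h
    exact y.2 (h ▸ P.zero_mem)
  obtain ⟨B, hB, hloc⟩ := IsLocalRing.exists_factor_valuationRing
    (IsLocalization.lift (M := P.primeCompl) (S := Localization.AtPrime P) hu)
  have hmem : ∀ r : R, algebraMap R (FractionRing R) r ∈ B := fun r ↦ by
    simpa using hB (algebraMap R (Localization.AtPrime P) r)
  refine ⟨B, hmem, fun r ↦ ?_⟩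
  have hval := B.valuation_lt_one_iff ⟨_, hmem r⟩
  rw [ValuationSubring.mem_nonunits_iff, ← hval, ← not_iff_not, IsLocalRing.mem_maximalIdeal,
    mem_nonunits_iff, not_not]
  have key := isUnit_map_iff (RingHom.codRestrict
    (IsLocalization.lift (M := P.primeCompl) (S := Localization.AtPrime P) hu) B.toSubring hB)
    (algebraMap R (Localization.AtPrime P) r)
  rw [IsLocalization.AtPrime.isUnit_to_map_iff (Localization.AtPrime P) P] at key
  refine Iff.trans (Eq.to_iff ?_) key
  congr 1
  ext
  simp

lemma IsHomFrac.inv {ι : Type*} {R : Type*} [CommRing R] [IsDomain R] {𝒜 : ι → AddSubgroup R}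
    {x : FractionRing R} (hx : IsHomFrac 𝒜 x) (hx0 : x ≠ 0) : IsHomFrac 𝒜 x⁻¹ := by
  obtain ⟨i, j, a, b, ha, hb, hb0, hab⟩ := hx
  refine ⟨j, i, b, a, hb, ha, ?_, ?_⟩
  · rintro rfl
    simp_all
  · rw [← hab, inv_mul_cancel_left₀ hx0]

namespace IsGrRing

variable {ι : Type*} [DecidableEq ι] {R : Type*} [CommRing R]

/-- The `GradedRing` structure underlying `IsGrRing`. -/
noncomputable abbrev gradedRing [AddCommMonoid ι] {𝒜 : ι → AddSubgroup R} (h : IsGrRing 𝒜) :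
    GradedRing 𝒜 :=
  { h.internal.chooseDecomposition with
    one_mem := h.one_mem
    mul_mem := fun _ _ _ _ ha hb ↦ h.mul_mem ha hb }

variable [IsDomain R]

section Monoid

variable [AddCommMonoid ι] {𝒜 : ι → AddSubgroup R}

lemma isHomFrac_mul (h : IsGrRing 𝒜) {x y : FractionRing R} (hx : IsHomFrac 𝒜 x)
    (hy : IsHomFrac 𝒜 y) : IsHomFrac 𝒜 (x * y) := by
  obtain ⟨i, j, a, b, ha, hb, hb0, hab⟩ := hx
  obtain ⟨k, l, c, d, hc, hd, hd0, hcd⟩ := hy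
  refine ⟨i + k, j + l, a * c, b * d, h.mul_mem ha hc, h.mul_mem hb hd, mul_ne_zero hb0 hd0, ?_⟩
  rw [map_mul, map_mul, ← hab, ← hcd]
  ring

/-- The homogeneous elements of the graded quotient field lying in a valuation ring. -/
def homFracSubmonoid (h : IsGrRing 𝒜) (B : ValuationSubring (FractionRing R)) :
    Submonoid (FractionRing R) where
  carrier := {y | y ∈ B ∧ IsHomFrac 𝒜 y}
  one_mem' := ⟨B.one_mem, 0, 0, 1, 1, h.one_mem, h.one_mem, one_ne_zero, by simp⟩
  mul_mem' := fun hx hy ↦ ⟨B.mul_mem _ _ hx.1 hy.1, h.isHomFrac_mul hx.2 hy.2⟩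

/-- The largest graded overring of `R` contained in a valuation ring containing `R`. -/
def gradedPart (h : IsGrRing 𝒜) (B : ValuationSubring (FractionRing R))
    (hB : ∀ r : R, algebraMap R (FractionRing R) r ∈ B) : Subalgebra R (FractionRing R) :=
  { (h.homFracSubmonoid B).subsemiringClosure with
    algebraMap_mem' := fun r ↦ by
      classical
      let := h.gradedRing
      change _ ∈ (h.homFracSubmonoid B).subsemiringClosure
      rw [← DirectSum.sum_support_decompose 𝒜 r, map_sum]
      refine sum_mem fun i _ ↦ AddSubmonoid.subset_closure ⟨hB _, i, 0, _, 1,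
        (DirectSum.decompose 𝒜 r i).2, h.one_mem, one_ne_zero, by simp⟩ }

variable (h : IsGrRing 𝒜) {B : ValuationSubring (FractionRing R)}
  (hB : ∀ r : R, algebraMap R (FractionRing R) r ∈ B)

lemma mem_gradedPart_iff {x : FractionRing R} : x ∈ h.gradedPart B hB ↔
    x ∈ AddSubmonoid.closure {y : FractionRing R | y ∈ B ∧ IsHomFrac 𝒜 y} :=
  Iff.rfl

lemma mem_gradedPart {x : FractionRing R} (hx : x ∈ B) (hx' : IsHomFrac 𝒜 x) :
    x ∈ h.gradedPart B hB :=
  AddSubmonoid.subset_closure ⟨hx, hx'⟩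

lemma mem_of_mem_gradedPart {x : FractionRing R} (hx : x ∈ h.gradedPart B hB) : x ∈ B :=
  (AddSubmonoid.closure_le (S := B.toSubring.toAddSubmonoid)).2 (fun _ hy ↦ hy.1) hx

lemma isGradedOverring_gradedPart : IsGradedOverring 𝒜 (h.gradedPart B hB) := by
  intro x hx
  refine AddSubmonoid.closure_mono ?_ hx
  exact fun y hy ↦ ⟨h.mem_gradedPart hB hy.1 hy.2, hy.2⟩

/-- The graded maximal ideal of the graded part of a valuation ring. -/
def gradedPartMaxIdeal : Ideal (h.gradedPart B hB) where
  carrier := {x | (x : FractionRing R) ∈ AddSubmonoid.closure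
    {y : FractionRing R | y ∈ B.nonunits ∧ IsHomFrac 𝒜 y}}
  add_mem' := fun ha hb ↦ by
    rw [Set.mem_ofPred_eq] at ha hb ⊢
    exact add_mem ha hb
  zero_mem' := by
    rw [Set.mem_ofPred_eq, ZeroMemClass.coe_zero]
    exact zero_mem _
  smul_mem' := by
    rintro ⟨c, hc⟩ ⟨x, hx'⟩ hx
    change c * x ∈ AddSubmonoid.closure _
    change x ∈ AddSubmonoid.closure _ at hx
    clear hx'
    rw [mem_gradedPart_iff] at hc
    induction hx using AddSubmonoid.closure_induction with
    | mem x hx =>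
      induction hc using AddSubmonoid.closure_induction with
      | mem c hc =>
        refine AddSubmonoid.subset_closure ⟨?_, h.isHomFrac_mul hc.2 hx.2⟩
        have hcB := (B.valuation_le_one_iff c).2 hc.1
        have hxB := hx.1
        rw [ValuationSubring.mem_nonunits_iff] at hxB ⊢
        rw [map_mul]
        exact (mul_le_of_le_one_left' hcB).trans_lt hxB
      | zero => simp
      | add _ _ _ _ h₁ h₂ =>
        rw [add_mul]
        exact add_mem h₁ h₂
    | zero => simp
    | add _ _ _ _ h₁ h₂ =>
      rw [mul_add]
      exact add_mem h₁ h₂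

lemma mem_gradedPartMaxIdeal_iff {x : h.gradedPart B hB} : x ∈ h.gradedPartMaxIdeal hB ↔
    (x : FractionRing R) ∈ AddSubmonoid.closure
      {y : FractionRing R | y ∈ B.nonunits ∧ IsHomFrac 𝒜 y} :=
  Iff.rfl

lemma mem_nonunits_of_mem_gradedPartMaxIdeal {x : h.gradedPart B hB}
    (hx : x ∈ h.gradedPartMaxIdeal hB) : (x : FractionRing R) ∈ B.nonunits :=
  (AddSubmonoid.closure_le (S := B.nonunits.toAddSubmonoid)).2 (fun _ hy ↦ hy.1)
    ((h.mem_gradedPartMaxIdeal_iff hB).1 hx)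

lemma gradedPartMaxIdeal_ne_top : h.gradedPartMaxIdeal hB ≠ ⊤ := by
  intro htop
  have h1 := h.mem_nonunits_of_mem_gradedPartMaxIdeal hB
    ((Ideal.eq_top_iff_one _).1 htop)
  simp [ValuationSubring.mem_nonunits_iff] at h1

lemma isHomIdealOver_gradedPartMaxIdeal :
    IsHomIdealOver 𝒜 (h.gradedPart B hB) (h.gradedPartMaxIdeal hB) := by
  intro x hx
  rw [mem_gradedPartMaxIdeal_iff] at hx
  refine AddSubmonoid.closure_mono ?_ hx
  rintro y ⟨hy, hy'⟩
  exact ⟨hy', h.mem_gradedPart hB ((B.valuation_le_one_iff y).1 (le_of_lt hy)) hy',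
    (h.mem_gradedPartMaxIdeal_iff hB).2 (AddSubmonoid.subset_closure ⟨hy, hy'⟩)⟩

lemma le_gradedPartMaxIdeal {J : Ideal (h.gradedPart B hB)}
    (hJ : IsHomIdealOver 𝒜 (h.gradedPart B hB) J) (hJ' : J ≠ ⊤) :
    J ≤ h.gradedPartMaxIdeal hB := by
  intro x hx
  rw [mem_gradedPartMaxIdeal_iff]
  refine AddSubmonoid.closure_mono ?_ (hJ x hx)
  rintro y ⟨hy, hyV, hyJ⟩
  refine ⟨?_, hy⟩
  rw [ValuationSubring.mem_nonunits_iff_or]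
  by_contra! hcon
  refine hJ' (Ideal.eq_top_of_isUnit_mem _ hyJ (IsUnit.of_mul_eq_one
    ⟨y⁻¹, h.mem_gradedPart hB hcon.2 (hy.inv hcon.1)⟩ ?_))
  ext
  simp [hcon.1]

lemma grLocalOver_gradedPart : GrLocalOver 𝒜 (h.gradedPart B hB) := by
  refine ⟨h.gradedPartMaxIdeal hB, ⟨h.isHomIdealOver_gradedPartMaxIdeal hB,
    h.gradedPartMaxIdeal_ne_top hB, fun J hJ hle hJ' ↦
      (h.le_gradedPartMaxIdeal hB hJ hJ').antisymm hle⟩, ?_⟩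
  rintro J ⟨hJ, hJ', hmax⟩
  exact (hmax _ (h.isHomIdealOver_gradedPartMaxIdeal hB) (h.le_gradedPartMaxIdeal hB hJ hJ')
    (h.gradedPartMaxIdeal_ne_top hB)).symm

/-- If the center of the valuation ring has height one, its graded part satisfies graded
going-down. -/
lemma ggd_gradedPart {P : Ideal R} (hP : HeightOnePrime P)
    (hBP : ∀ r : R, algebraMap R (FractionRing R) r ∈ B.nonunits → r ∈ P) :
    GGD 𝒜 (h.gradedPart B hB) := by
  rintro P' Q Qt hP' - hQt - - hQth hPQ rfl
  rcases hPQ.eq_or_lt with rfl | hlt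
  · exact ⟨Qt, hQt, hQth, le_rfl, rfl⟩
  have hQP : Qt.comap (algebraMap R (h.gradedPart B hB)) ≤ P := fun r hr ↦
    hBP r (h.mem_nonunits_of_mem_gradedPartMaxIdeal hB
      (h.le_gradedPartMaxIdeal hB hQth hQt.ne_top hr))
  obtain rfl := hP.2.2 P' hP' (hlt.trans_le hQP)
  refine ⟨⊥, Ideal.isPrime_bot, fun x hx ↦ ?_, bot_le, ?_⟩
  · rw [(Submodule.mem_bot _).1 hx]
    exact zero_mem _
  · exact Ideal.comap_bot_of_injective _ (FaithfulSMul.algebraMap_injective R _)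

end Monoid

/-- A homogeneous fraction with some denominator outside `P` has a homogeneous denominator
outside `P`. -/
lemma mem_homLocR_of_mul_eq [AddCommGroup ι] {𝒜 : ι → AddSubgroup R} (h : IsGrRing 𝒜)
    {P : Ideal R} {x : FractionRing R} (hx : IsHomFrac 𝒜 x) {r w : R} (hw : w ∉ P)
    (hxw : x * algebraMap R (FractionRing R) w = algebraMap R (FractionRing R) r) :
    x ∈ HomLocR 𝒜 P := by
  classical
  let := h.gradedRing
  obtain ⟨i, j, a, b, ha, hb, hb0, hab⟩ := hx
  obtain ⟨k, hk⟩ : ∃ k, (DirectSum.decompose 𝒜 w k : R) ∉ P := by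
    by_contra! hall
    refine hw ?_
    rw [← DirectSum.sum_support_decompose 𝒜 w]
    exact sum_mem fun k _ ↦ hall k
  have hinj := FaithfulSMul.algebraMap_injective R (FractionRing R)
  have haw : a * w = b * r := by
    apply hinj
    rw [map_mul, map_mul, ← hab, ← hxw]
    ring
  have hcomp : a * DirectSum.decompose 𝒜 w k = b * DirectSum.decompose 𝒜 r (i + k - j) := by
    rw [← DirectSum.coe_decompose_mul_add_of_left_mem 𝒜 ha,
      ← DirectSum.coe_decompose_mul_add_of_left_mem 𝒜 hb, haw, add_sub_cancel]
  refine Algebra.subset_adjoin ⟨DirectSum.decompose 𝒜 r (i + k - j), DirectSum.decompose 𝒜 w k,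
    ⟨k, (DirectSum.decompose 𝒜 w k).2⟩, hk, ?_⟩
  have hb0' : algebraMap R (FractionRing R) b ≠ 0 := fun h0 ↦ hb0 (hinj (h0.trans (map_zero _).symm))
  apply mul_left_cancel₀ hb0'
  rw [← map_mul, ← hcomp, map_mul, ← hab]
  ring

end IsGrRing

/-- Let `R` be a `G`-graded domain. If `R` is a graded perinormal domain,
then `R` is a gr-(R₁) domain. -/
theorem grR1_of_gradedPerinormal
    {G : Type*} [DecidableEq G] [AddCommGroup G] (hG : ∀ g : G, g ≠ 0 → ¬IsOfFinAddOrder g)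
    {R : Type*} [CommRing R] [IsDomain R]
    (𝒜 : G → AddSubgroup R) (hGr : IsGrRing 𝒜)
    (hperi : GradedPerinormal 𝒜) :
    GrR1 𝒜 := by
  intro P hP _
  have := hP.1
  obtain ⟨B, hB, hBP⟩ := exists_valuationSubring_center_eq P
  obtain ⟨W, hW, hfrac⟩ := hperi _ (hGr.isGradedOverring_gradedPart hB)
    (hGr.grLocalOver_gradedPart hB) (hGr.ggd_gradedPart hB hP fun r ↦ (hBP r).1)
  have hmem : ∀ x ∈ B, IsHomFrac 𝒜 x → x ∈ HomLocR 𝒜 P := by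
    intro x hxB hx
    obtain ⟨r, w, hw, hxw⟩ := hfrac ⟨x, hGr.mem_gradedPart hB hxB hx⟩
    refine hGr.mem_homLocR_of_mul_eq hx (w := w) (r := r) (fun hwP ↦ ?_) (congrArg Subtype.val hxw)
    obtain ⟨u, hu⟩ := (hW w hw).exists_right_inv
    have hu' : algebraMap R (FractionRing R) w * (u : FractionRing R) = 1 :=
      congrArg Subtype.val hu
    rcases B.mem_nonunits_iff_or.1 ((hBP w).2 hwP) with h0 | h0
    · rw [h0, zero_mul] at hu'
      exact zero_ne_one hu'
    · rw [inv_eq_of_mul_eq_one_right hu'] at h0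
      exact h0 (hGr.mem_of_mem_gradedPart hB u.2)
  intro x hx0 hx
  exact (B.mem_or_inv_mem x).imp (hmem x · hx) (hmem x⁻¹ · (hx.inv hx0))
end

section
/- Let R be a ℤ-graded Noetherian domain that is a gr-(R₁) domain and let S be a graded overring of R satisfying graded going-down (gGD). Then S is a gr-(R₁) domain, and contraction of prime ideals induces an injective map from the height-one homogeneous primes of S to the height-one homogeneous primes of R whose image is exactly the set of height-one homogeneous primes 𝔭 of R with 𝔭S ≠ S. -/
section GradedRings

variable {ι : Type*} [DecidableEq ι] [AddCommMonoid ι]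

/-- The `GradedRing` structure carried by a ring with an internal grading. -/
@[reducible]
noncomputable def IsGrRing.gradedRing_s10 {A : Type*} [CommRing A] {𝒜 : ι → AddSubgroup A}
    (h : IsGrRing 𝒜) : GradedRing 𝒜 :=
  { h.internal.chooseDecomposition with
    one_mem := h.one_mem
    mul_mem := fun _ _ _ _ ha hb => h.mul_mem ha hb }

theorem isHomIdeal_iff_isHomogeneous {A : Type*} [CommRing A] (𝒜 : ι → AddSubgroup A)
    [GradedRing 𝒜] (I : Ideal A) : IsHomIdeal 𝒜 I ↔ I.IsHomogeneous 𝒜 := by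
  constructor
  · intro h
    have hI : I = Ideal.span {y : A | SetLike.IsHomogeneousElem 𝒜 y ∧ y ∈ I} := by
      refine le_antisymm (fun x hx => ?_) (Ideal.span_le.mpr fun y hy => hy.2)
      refine AddSubmonoid.closure_le (S := (Ideal.span _).toAddSubmonoid).mpr ?_ (h x hx)
      exact Ideal.subset_span
    rw [hI]
    exact Ideal.homogeneous_span 𝒜 _ fun y hy => hy.1
  · classical
    intro h x hx
    rw [← DirectSum.sum_support_decompose 𝒜 x]
    exact sum_mem fun i _ => AddSubmonoid.subset_closure
      ⟨⟨i, SetLike.coe_mem _⟩, h i hx⟩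

theorem IsHomIdeal.comap {A B : Type*} [CommRing A] [CommRing B] {𝒜 : ι → AddSubgroup A}
    {ℬ : ι → AddSubgroup B} (hA : IsGrRing 𝒜) (hB : IsGrRing ℬ) (f : A →+* B)
    (hf : ∀ i, ∀ a ∈ 𝒜 i, f a ∈ ℬ i) {I : Ideal B} (hI : IsHomIdeal ℬ I) :
    IsHomIdeal 𝒜 (I.comap f) := by
  let := hA.gradedRing_s10
  let := hB.gradedRing_s10
  rw [isHomIdeal_iff_isHomogeneous] at hI ⊢
  have key : ∀ (x : A) (i : ι),
      f (DirectSum.decompose 𝒜 x i) = DirectSum.decompose ℬ (f x) i := by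
    intro x i
    induction x using DirectSum.Decomposition.inductionOn 𝒜 with
    | zero => simp
    | @homogeneous j m =>
      rw [DirectSum.decompose_coe, DirectSum.decompose_of_mem ℬ (hf j m m.2)]
      by_cases hij : j = i
      · subst hij; simp
      · rw [DirectSum.of_eq_of_ne _ _ _ (Ne.symm hij), DirectSum.of_eq_of_ne _ _ _ (Ne.symm hij)]
        simp
    | add a b ha hb => simp [DirectSum.decompose_add, ha, hb]
  intro i x hx
  rw [Ideal.mem_comap, key]
  exact hI i hx

theorem IsGrRing.exists_prime_isHomIdeal_le {A : Type*} [CommRing A] {𝒜 : ℤ → AddSubgroup A}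
    (h : IsGrRing 𝒜) (P : Ideal A) (hP : P.IsPrime) :
    ∃ P' : Ideal A, P'.IsPrime ∧ IsHomIdeal 𝒜 P' ∧ P' ≤ P ∧
      ∀ x ∈ P, SetLike.IsHomogeneousElem 𝒜 x → x ∈ P' := by
  let := h.gradedRing_s10
  exact ⟨(P.homogeneousCore 𝒜).toIdeal, hP.homogeneousCore,
    (isHomIdeal_iff_isHomogeneous 𝒜 _).mpr (P.homogeneousCore 𝒜).isHomogeneous,
    P.toIdeal_homogeneousCore_le 𝒜,
    fun x hx hx' => Ideal.mem_homogeneousCore_of_homogeneous_of_mem hx' hx⟩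

theorem IsHomIdeal.exists_ne_zero {κ A : Type*} [CommRing A] {𝒜 : κ → AddSubgroup A}
    {I : Ideal A} (hI : IsHomIdeal 𝒜 I) (h0 : I ≠ ⊥) :
    ∃ x ∈ I, SetLike.IsHomogeneousElem 𝒜 x ∧ x ≠ 0 := by
  by_contra! hcon
  refine h0 (eq_bot_iff.mpr fun x hx => ?_)
  refine AddSubmonoid.closure_le (S := (⊥ : Ideal A).toAddSubmonoid).mpr ?_ (hI x hx)
  exact fun y hy => hcon y hy.2 hy.1

/-- A graded form of Krull's principal ideal theorem: a nonzero homogeneous prime of a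
Noetherian graded domain contains a homogeneous prime of height one. -/
theorem IsHomIdeal.exists_heightOnePrime_le {A : Type*} [CommRing A] [IsDomain A]
    [IsNoetherianRing A] {𝒜 : ℤ → AddSubgroup A} (hA : IsGrRing 𝒜) {P : Ideal A}
    (hP : P.IsPrime) (hPhom : IsHomIdeal 𝒜 P) (h0 : P ≠ ⊥) :
    ∃ 𝔭 : Ideal A, HeightOnePrime 𝔭 ∧ IsHomIdeal 𝒜 𝔭 ∧ 𝔭 ≤ P := by
  obtain ⟨x, hxP, hxhom, hx0⟩ := hPhom.exists_ne_zero h0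
  obtain ⟨𝔭, hmin, hle⟩ := Ideal.exists_minimalPrimes_le
    ((Ideal.span_singleton_le_iff_mem P).mpr hxP)
  have hprime : 𝔭.IsPrime := hmin.1.1
  have hx𝔭 : x ∈ 𝔭 := hmin.1.2 (Ideal.mem_span_singleton_self x)
  refine ⟨𝔭, ⟨hprime, fun h => hx0 (by simpa [h] using hx𝔭), fun Q hQ hlt => ?_⟩, ?_, hle⟩
  · have hht : Q.height < 1 := Ideal.height_le_iff.mp
      (Ideal.height_le_one_of_isPrincipal_of_mem_minimalPrimes _ 𝔭 hmin) Q hQ hlt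
    exact Ideal.height_eq_zero_iff_eq_bot.mp (Order.lt_one_iff.mp hht)
  · obtain ⟨𝔭', hprime', hhom', hle', hmem⟩ := hA.exists_prime_isHomIdeal_le 𝔭 hprime
    have : 𝔭 ≤ 𝔭' := hmin.2 ⟨hprime', (Ideal.span_singleton_le_iff_mem _).mpr
      (hmem x hx𝔭 hxhom)⟩ hle'
    exact le_antisymm hle' this ▸ hhom'

theorem IsGrRing.eq_zero_of_sum_eq_zero {R : Type*} [CommRing R] {𝒜 : ℤ → AddSubgroup R}
    (hGr : IsGrRing 𝒜) (s : Finset ℤ) (a : ℤ → R) (j : ℤ)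
    (ha : ∀ n ∈ s, a n ∈ 𝒜 (j + n)) (hsum : ∑ n ∈ s, a n = 0) : ∀ n ∈ s, a n = 0 := by
  let := hGr.gradedRing_s10
  intro n hn
  have h : ((DirectSum.decompose 𝒜 (∑ m ∈ s, a m)) (j + n) : R) = a n := by
    rw [DirectSum.decompose_sum, DFinsupp.finsetSum_apply, AddSubgroup.val_finsetSum,
      Finset.sum_eq_single n]
    · exact DirectSum.decompose_of_mem_same 𝒜 (ha n hn)
    · intro m hm hmn
      exact DirectSum.decompose_of_mem_ne 𝒜 (ha m hm) (by simpa using hmn)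
    · exact fun h => absurd hn h
  rw [← h, hsum]
  simp

theorem exists_mul_eq_of_mem_homLocR {κ R : Type*} [CommRing R] {𝒜 : κ → AddSubgroup R}
    {P : Ideal R} (hP : P.IsPrime)
    {x : FractionRing R} (hx : x ∈ HomLocR 𝒜 P) :
    ∃ a w : R, w ∉ P ∧
      x * algebraMap R (FractionRing R) w = algebraMap R (FractionRing R) a := by
  induction hx using Algebra.adjoin_induction with
  | mem x hx =>
    obtain ⟨a, w, -, hw, h⟩ := hx
    exact ⟨a, w, hw, h⟩
  | algebraMap r => exact ⟨r, 1, hP.one_notMem, by simp⟩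
  | add x y _ _ hx hy =>
    obtain ⟨a, w, hw, h⟩ := hx
    obtain ⟨a', w', hw', h'⟩ := hy
    refine ⟨a * w' + a' * w, w * w', hP.mul_notMem hw hw', ?_⟩
    simp only [map_mul, map_add, ← h, ← h']; ring
  | mul x y _ _ hx hy =>
    obtain ⟨a, w, hw, h⟩ := hx
    obtain ⟨a', w', hw', h'⟩ := hy
    refine ⟨a * a', w * w', hP.mul_notMem hw hw', ?_⟩
    simp only [map_mul, ← h, ← h']; ring

end GradedRings

section GradedOverrings

variable {R : Type*} [CommRing R] [IsDomain R] {𝒜 : ℤ → AddSubgroup R}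

/-- The degree `n` component of the graded quotient field of `R`. -/
def IsGrRing.fracComponent (hGr : IsGrRing 𝒜) (n : ℤ) : AddSubgroup (FractionRing R) where
  carrier := {x | ∃ (j : ℤ) (a b : R), a ∈ 𝒜 (j + n) ∧ b ∈ 𝒜 j ∧ b ≠ 0 ∧
    x * algebraMap R (FractionRing R) b = algebraMap R (FractionRing R) a}
  zero_mem' := ⟨0, 0, 1, zero_mem _, hGr.one_mem, one_ne_zero, by simp⟩
  add_mem' := by
    rintro x y ⟨j, a, b, ha, hb, hb0, hx⟩ ⟨j', a', b', ha', hb', hb0', hy⟩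
    refine ⟨j + j', a * b' + a' * b, b * b', add_mem ?_ ?_, hGr.mul_mem hb hb',
      mul_ne_zero hb0 hb0', ?_⟩
    · rw [show j + j' + n = j + n + j' by ring]; exact hGr.mul_mem ha hb'
    · rw [show j + j' + n = j' + n + j by ring]; exact hGr.mul_mem ha' hb
    · simp only [map_mul, map_add, ← hx, ← hy]; ring
  neg_mem' := by
    rintro x ⟨j, a, b, ha, hb, hb0, hx⟩
    exact ⟨j, -a, b, neg_mem ha, hb, hb0, by simp [hx]⟩

theorem IsGrRing.isHomFrac_iff (hGr : IsGrRing 𝒜) (x : FractionRing R) :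
    IsHomFrac 𝒜 x ↔ ∃ n, x ∈ hGr.fracComponent n := by
  constructor
  · rintro ⟨i, j, a, b, ha, hb, hb0, hx⟩
    exact ⟨i - j, j, a, b, by simpa using ha, hb, hb0, hx⟩
  · rintro ⟨n, j, a, b, ha, hb, hb0, hx⟩
    exact ⟨j + n, j, a, b, ha, hb, hb0, hx⟩

theorem IsGrRing.algebraMap_mem_fracComponent (hGr : IsGrRing 𝒜) {n : ℤ} {a : R}
    (ha : a ∈ 𝒜 n) : algebraMap R (FractionRing R) a ∈ hGr.fracComponent n :=
  ⟨0, a, 1, by simpa using ha, hGr.one_mem, one_ne_zero, by simp⟩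

theorem IsGrRing.mul_mem_fracComponent (hGr : IsGrRing 𝒜) {m n : ℤ} {x y : FractionRing R}
    (hx : x ∈ hGr.fracComponent m) (hy : y ∈ hGr.fracComponent n) :
    x * y ∈ hGr.fracComponent (m + n) := by
  obtain ⟨j, a, b, ha, hb, hb0, hx⟩ := hx
  obtain ⟨j', a', b', ha', hb', hb0', hy⟩ := hy
  refine ⟨j + j', a * a', b * b', ?_, hGr.mul_mem hb hb', mul_ne_zero hb0 hb0', ?_⟩
  · rw [show j + j' + (m + n) = (j + m) + (j' + n) by ring]
    exact hGr.mul_mem ha ha'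
  · simp only [map_mul, ← hx, ← hy]; ring

theorem IsGrRing.exists_common_denominator (hGr : IsGrRing 𝒜) (s : Finset ℤ)
    (x : ℤ → FractionRing R) (hx : ∀ n, x n ∈ hGr.fracComponent n) :
    ∃ (j : ℤ) (d : R), d ∈ 𝒜 j ∧ d ≠ 0 ∧ ∀ n ∈ s, ∃ a ∈ 𝒜 (j + n),
      x n * algebraMap R (FractionRing R) d = algebraMap R (FractionRing R) a := by
  induction s using Finset.induction_on with
  | empty => exact ⟨0, 1, hGr.one_mem, one_ne_zero, by simp⟩
  | insert m s _ ih =>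
    obtain ⟨j, d, hd, hd0, hs⟩ := ih
    obtain ⟨j', a', b', ha', hb', hb0', hm⟩ := hx m
    refine ⟨j + j', d * b', hGr.mul_mem hd hb', mul_ne_zero hd0 hb0', fun n hn => ?_⟩
    rcases Finset.mem_insert.mp hn with rfl | hn
    · refine ⟨a' * d, ?_, ?_⟩
      · rw [show j + j' + n = j' + n + j by ring]; exact hGr.mul_mem ha' hd
      · simp only [map_mul, ← hm]; ring
    · obtain ⟨a, ha, hxa⟩ := hs n hn
      refine ⟨a * b', ?_, ?_⟩
      · rw [show j + j' + n = j + n + j' by ring]; exact hGr.mul_mem ha hb'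
      · simp only [map_mul, ← hxa]; ring

theorem IsGrRing.frac_eq_zero_of_sum_eq_zero (hGr : IsGrRing 𝒜) (s : Finset ℤ)
    (x : ℤ → FractionRing R) (hx : ∀ n, x n ∈ hGr.fracComponent n)
    (hsum : ∑ n ∈ s, x n = 0) : ∀ n ∈ s, x n = 0 := by
  obtain ⟨j, d, -, hd0, h⟩ := hGr.exists_common_denominator s x hx
  choose! a ha hxa using h
  have hinj := IsFractionRing.injective R (FractionRing R)
  have hzero : ∑ n ∈ s, a n = 0 := by
    apply hinj
    rw [map_sum, map_zero, ← Finset.sum_congr rfl hxa, ← Finset.sum_mul, hsum, zero_mul]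
  intro n hn
  have h0 := hxa n hn
  rw [hGr.eq_zero_of_sum_eq_zero s a j ha hzero n hn, map_zero] at h0
  exact (mul_eq_zero.mp h0).resolve_right fun h => hd0 (hinj (by simpa using h))

variable (S : Subalgebra R (FractionRing R))

/-- The degree `n` component of an overring. -/
def IsGrRing.overringComponent (hGr : IsGrRing 𝒜) (n : ℤ) : AddSubgroup S :=
  (hGr.fracComponent n).comap S.val.toAddMonoidHom

variable {S}

theorem IsGrRing.mem_overringComponent (hGr : IsGrRing 𝒜) {n : ℤ} {x : S} :
    x ∈ hGr.overringComponent S n ↔ (x : FractionRing R) ∈ hGr.fracComponent n :=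
  Iff.rfl

theorem IsGrRing.isHomogeneousElem_overring_iff (hGr : IsGrRing 𝒜) {x : S} :
    SetLike.IsHomogeneousElem (hGr.overringComponent S) x ↔
      IsHomFrac 𝒜 (x : FractionRing R) :=
  (hGr.isHomFrac_iff _).symm

theorem IsGradedOverring.isGrRing (hS : IsGradedOverring 𝒜 S) (hGr : IsGrRing 𝒜) :
    IsGrRing (hGr.overringComponent S) where
  one_mem := by
    rw [hGr.mem_overringComponent]
    simpa using hGr.algebraMap_mem_fracComponent hGr.one_mem
  mul_mem := fun ha hb => hGr.mul_mem_fracComponent ha hb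
  internal := by
    classical
    constructor
    · refine (injective_iff_map_eq_zero _).mpr fun f hf => ?_
      have hsum : ∑ n ∈ f.support, ((f n : S) : FractionRing R) = 0 := by
        have := congrArg S.val hf
        rw [DirectSum.coeAddMonoidHom_eq_dfinsuppSum, DFinsupp.sum, map_sum] at this
        simpa using this
      ext n
      by_cases hn : n ∈ f.support
      · simpa using hGr.frac_eq_zero_of_sum_eq_zero f.support (fun n => ((f n : S) : FractionRing R))
          (fun n => (f n).2) hsum n hn
      · simpa using hn
    · intro x
      suffices h : ∀ y (_ : y ∈ AddSubmonoid.closure {y | y ∈ S ∧ IsHomFrac 𝒜 y}),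
          ∃ z, ((DirectSum.coeAddMonoidHom (hGr.overringComponent S) z : S) :
            FractionRing R) = y by
        obtain ⟨z, hz⟩ := h x (hS x x.2)
        exact ⟨z, Subtype.ext hz⟩
      intro y hy
      induction hy using AddSubmonoid.closure_induction with
      | mem y hy =>
        obtain ⟨n, hn⟩ := (hGr.isHomFrac_iff y).mp hy.2
        exact ⟨DirectSum.of (fun n => hGr.overringComponent S n) n ⟨⟨y, hy.1⟩, hn⟩, by simp⟩
      | zero => exact ⟨0, by simp⟩
      | add y₁ y₂ _ _ h₁ h₂ =>
        obtain ⟨z₁, rfl⟩ := h₁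
        obtain ⟨z₂, rfl⟩ := h₂
        exact ⟨z₁ + z₂, by simp⟩

theorem IsGrRing.isHomIdealOver_iff (hGr : IsGrRing 𝒜) (I : Ideal S) :
    IsHomIdealOver 𝒜 S I ↔ IsHomIdeal (hGr.overringComponent S) I := by
  have himage : {y : FractionRing R | IsHomFrac 𝒜 y ∧ ∃ h : y ∈ S, (⟨y, h⟩ : S) ∈ I} =
      S.val.toAddMonoidHom ''
        {y : S | SetLike.IsHomogeneousElem (hGr.overringComponent S) y ∧ y ∈ I} := by
    ext y
    constructor
    · rintro ⟨h, hy, hI⟩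
      exact ⟨⟨y, hy⟩, ⟨hGr.isHomogeneousElem_overring_iff.mpr h, hI⟩, rfl⟩
    · rintro ⟨y, ⟨h, hI⟩, rfl⟩
      exact ⟨hGr.isHomogeneousElem_overring_iff.mp h, y.2, hI⟩
  unfold IsHomIdealOver IsHomIdeal
  refine forall₂_congr fun x _ => ?_
  rw [himage, ← AddMonoidHom.map_mclosure, AddSubmonoid.mem_map]
  constructor
  · rintro ⟨y, hy, hyx⟩
    rwa [← Subtype.ext (show (y : FractionRing R) = x from hyx)]
  · exact fun hx => ⟨x, hx, rfl⟩

theorem IsHomIdealOver.comap_algebraMap (hGr : IsGrRing 𝒜) (hS : IsGradedOverring 𝒜 S)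
    {Q : Ideal S} (hQ : IsHomIdealOver 𝒜 S Q) :
    IsHomIdeal 𝒜 (Q.comap (algebraMap R S)) :=
  IsHomIdeal.comap hGr (hS.isGrRing hGr) (algebraMap R S)
    (fun _ _ ha => hGr.algebraMap_mem_fracComponent ha) ((hGr.isHomIdealOver_iff Q).mp hQ)

/-- A proper homogeneous extension is contained in a homogeneous prime. -/
theorem exists_prime_isHomIdealOver_of_map_ne_top (hGr : IsGrRing 𝒜)
    (hS : IsGradedOverring 𝒜 S) {I : Ideal R} (hI : IsHomIdeal 𝒜 I)
    (h : I.map (algebraMap R S) ≠ ⊤) :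
    ∃ M : Ideal S, M.IsPrime ∧ IsHomIdealOver 𝒜 S M ∧ I ≤ M.comap (algebraMap R S) := by
  obtain ⟨M, hM, hle⟩ := Ideal.exists_le_maximal _ h
  obtain ⟨M', hprime, hhom, -, hmem⟩ :=
    (hS.isGrRing hGr).exists_prime_isHomIdeal_le M hM.isPrime
  refine ⟨M', hprime, (hGr.isHomIdealOver_iff M').mpr hhom, fun x hx => ?_⟩
  refine AddSubmonoid.closure_le
    (S := (M'.comap (algebraMap R S)).toAddSubmonoid).mpr ?_ (hI x hx)
  rintro y ⟨⟨n, hn⟩, hy⟩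
  exact hmem _ (hle (Ideal.mem_map_of_mem _ hy)) ⟨n, hGr.algebraMap_mem_fracComponent hn⟩

theorem homLocR_comap_le_homLocOver (hGr : IsGrRing 𝒜) (Q : Ideal S) :
    HomLocR 𝒜 (Q.comap (algebraMap R S)) ≤ HomLocOver 𝒜 S Q := by
  refine Algebra.adjoin_mono ?_
  rintro x ⟨a, w, ⟨n, hn⟩, hw, h⟩
  exact ⟨algebraMap R S a, algebraMap R S w,
    (hGr.isHomFrac_iff _).mpr ⟨n, hGr.algebraMap_mem_fracComponent hn⟩, hw, h⟩

theorem eq_bot_of_comap_algebraMap_eq_bot {Q : Ideal S}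
    (h : Q.comap (algebraMap R S) = ⊥) : Q = ⊥ := by
  refine eq_bot_iff.mpr fun x hx => ?_
  obtain ⟨a, b, hb, hab⟩ := IsFractionRing.div_surjective (A := R) (x : FractionRing R)
  have hb0 : algebraMap R (FractionRing R) b ≠ 0 :=
    IsFractionRing.to_map_ne_zero_of_mem_nonZeroDivisors hb
  have hxa : x * algebraMap R S b = algebraMap R S a := by
    apply Subtype.ext
    change (x : FractionRing R) * algebraMap R (FractionRing R) b =
      algebraMap R (FractionRing R) a
    rw [← hab, div_mul_cancel₀ _ hb0]
  have ha : a ∈ Q.comap (algebraMap R S) := by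
    rw [Ideal.mem_comap, ← hxa]
    exact Q.mul_mem_right _ hx
  rw [h, Ideal.mem_bot] at ha
  refine Subtype.ext ?_
  rw [← hab, ha]
  simp

/-- If `R_(𝔭)` is a gr-valuation domain, a homogeneous prime of an overring lying over `𝔭` is
contained in every prime lying over `𝔭`. -/
theorem IsHomIdealOver.le_of_comap_eq (hGr : IsGrRing 𝒜) {𝔭 : Ideal R} (h𝔭 : 𝔭.IsPrime)
    (hval : GrValuation 𝒜 (HomLocR 𝒜 𝔭)) {Q Q' : Ideal S} (hQhom : IsHomIdealOver 𝒜 S Q)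
    (hQ' : Q'.IsPrime) (hQ𝔭 : Q.comap (algebraMap R S) = 𝔭)
    (hQ'𝔭 : Q'.comap (algebraMap R S) = 𝔭) : Q ≤ Q' := by
  intro x hx
  refine AddSubmonoid.closure_le (S := Q'.toAddSubmonoid).mpr ?_
    ((hGr.isHomIdealOver_iff Q).mp hQhom x hx)
  rintro s ⟨hs, hsQ⟩
  by_cases hs0 : s = 0
  · exact hs0 ▸ Q'.zero_mem
  have hs0' : (s : FractionRing R) ≠ 0 := fun h => hs0 (Subtype.ext h)
  have mem_Q : ∀ r, algebraMap R S r ∈ Q ↔ r ∈ 𝔭 := fun r => by rw [← hQ𝔭]; rfl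
  have mem_Q' : ∀ r, algebraMap R S r ∈ Q' ↔ r ∈ 𝔭 := fun r => by rw [← hQ'𝔭]; rfl
  rcases hval s hs0' (hGr.isHomogeneousElem_overring_iff.mp hs) with h | h
  · obtain ⟨a, w, hw, h⟩ := exists_mul_eq_of_mem_homLocR h𝔭 h
    have hsw : s * algebraMap R S w = algebraMap R S a := Subtype.ext h
    have ha : a ∈ 𝔭 := (mem_Q a).mp (hsw ▸ Q.mul_mem_right _ hsQ)
    have : s * algebraMap R S w ∈ Q' := hsw ▸ (mem_Q' a).mpr ha
    exact (hQ'.mem_or_mem this).resolve_right fun hw' => hw ((mem_Q' w).mp hw')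
  · obtain ⟨a, w, hw, h⟩ := exists_mul_eq_of_mem_homLocR h𝔭 h
    have hsa : s * algebraMap R S a = algebraMap R S w := by
      apply Subtype.ext
      change (s : FractionRing R) * algebraMap R (FractionRing R) a =
        algebraMap R (FractionRing R) w
      rw [← h, mul_inv_cancel_left₀ hs0']
    exact absurd ((mem_Q w).mp (hsa ▸ Q.mul_mem_right _ hsQ)) hw

end GradedOverrings

/-- Let `R` be a `ℤ`-graded Noetherian gr-(R₁) domain and let `S` be a graded
overring of `R` satisfying graded going-down. Then `S` is gr-(R₁), and contraction induces an
injective map from height-one homogeneous primes of `S` to height-one homogeneous primes of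
`R` whose image consists of the height-one homogeneous primes `𝔭` of `R` with `𝔭S ≠ S`. -/
theorem grR1_overring_and_heightOne_contraction
    {R : Type*} [CommRing R] [IsDomain R] [IsNoetherianRing R]
    (𝒜 : ℤ → AddSubgroup R) (hGr : IsGrRing 𝒜) (hR1 : GrR1 𝒜)
    (S : Subalgebra R (FractionRing R)) (hS : IsGradedOverring 𝒜 S) (hggd : GGD 𝒜 S) :
    (∀ Q : Ideal S, HeightOnePrime Q → IsHomIdealOver 𝒜 S Q →
        GrValuation 𝒜 (HomLocOver 𝒜 S Q)) ∧
    (∀ Q : Ideal S, HeightOnePrime Q → IsHomIdealOver 𝒜 S Q →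
        HeightOnePrime (Q.comap (algebraMap R S)) ∧
        IsHomIdeal 𝒜 (Q.comap (algebraMap R S))) ∧
    (∀ Q₁ Q₂ : Ideal S, HeightOnePrime Q₁ → IsHomIdealOver 𝒜 S Q₁ →
        HeightOnePrime Q₂ → IsHomIdealOver 𝒜 S Q₂ →
        Q₁.comap (algebraMap R S) = Q₂.comap (algebraMap R S) → Q₁ = Q₂) ∧
    (∀ 𝔭 : Ideal R, HeightOnePrime 𝔭 → IsHomIdeal 𝒜 𝔭 →
        ((∃ Q : Ideal S, HeightOnePrime Q ∧ IsHomIdealOver 𝒜 S Q ∧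
            Q.comap (algebraMap R S) = 𝔭) ↔
          Ideal.map (algebraMap R S) 𝔭 ≠ ⊤)) := by
  have hcontr : ∀ Q : Ideal S, HeightOnePrime Q → IsHomIdealOver 𝒜 S Q →
      HeightOnePrime (Q.comap (algebraMap R S)) ∧
      IsHomIdeal 𝒜 (Q.comap (algebraMap R S)) := by
    intro Q hQ hQhom
    have hQprime := hQ.1
    have hPhom := hQhom.comap_algebraMap hGr hS
    have hPprime : (Q.comap (algebraMap R S)).IsPrime := Ideal.comap_isPrime _ _
    have hP0 : Q.comap (algebraMap R S) ≠ ⊥ :=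
      fun h => hQ.2.1 (eq_bot_of_comap_algebraMap_eq_bot h)
    obtain ⟨𝔭, h𝔭, h𝔭hom, hle⟩ := hPhom.exists_heightOnePrime_le hGr hPprime hP0
    obtain ⟨Pt, hPt, -, hPtQ, hPt𝔭⟩ :=
      hggd 𝔭 _ Q h𝔭.1 hPprime hQprime h𝔭hom hPhom hQhom hle rfl
    have hPt0 : Pt ≠ ⊥ := by
      rintro rfl
      refine h𝔭.2.1 (hPt𝔭 ▸ ?_)
      exact (RingHom.injective_iff_ker_eq_bot _).mp (FaithfulSMul.algebraMap_injective R S)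
    have hPtQ' : Pt = Q := by
      by_contra hne
      exact hPt0 (hQ.2.2 Pt hPt (lt_of_le_of_ne hPtQ hne))
    exact ⟨by rw [← hPtQ', hPt𝔭]; exact h𝔭, hPhom⟩
  refine ⟨fun Q hQ hQhom x hx0 hx => ?_, hcontr, ?_, ?_⟩
  · obtain ⟨h1, h2⟩ := hcontr Q hQ hQhom
    exact (hR1 _ h1 h2 x hx0 hx).imp (fun h => homLocR_comap_le_homLocOver hGr Q h)
      (fun h => homLocR_comap_le_homLocOver hGr Q h)
  · intro Q₁ Q₂ h₁ hhom₁ h₂ hhom₂ heq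
    obtain ⟨hP, hPhom⟩ := hcontr Q₂ h₂ hhom₂
    have hval := hR1 _ hP hPhom
    exact le_antisymm (hhom₁.le_of_comap_eq hGr hP.1 hval h₂.1 heq rfl)
      (hhom₂.le_of_comap_eq hGr hP.1 hval h₁.1 rfl heq)
  · intro 𝔭 h𝔭 h𝔭hom
    constructor
    · rintro ⟨Q, hQ, -, rfl⟩ htop
      exact hQ.1.ne_top (top_le_iff.mp (htop ▸ Ideal.map_comap_le))
    · intro htop
      obtain ⟨M, hM, hMhom, hle⟩ :=
        exists_prime_isHomIdealOver_of_map_ne_top hGr hS h𝔭hom htop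
      obtain ⟨Q, hQ, hQhom, -, hQ𝔭⟩ := hggd 𝔭 _ M h𝔭.1 (Ideal.comap_isPrime _ _) hM h𝔭hom
        (hMhom.comap_algebraMap hGr hS) hMhom hle rfl
      refine ⟨Q, ⟨hQ, ?_, fun Q' hQ' hlt => ?_⟩, hQhom, hQ𝔭⟩
      · rintro rfl
        refine h𝔭.2.1 (hQ𝔭 ▸ ?_)
        exact (RingHom.injective_iff_ker_eq_bot _).mp (FaithfulSMul.algebraMap_injective R S)
      · have hle' : Q'.comap (algebraMap R S) ≤ 𝔭 := hQ𝔭 ▸ Ideal.comap_mono hlt.le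
        by_cases heq : Q'.comap (algebraMap R S) = 𝔭
        · exact absurd (hQhom.le_of_comap_eq hGr h𝔭.1 (hR1 𝔭 h𝔭 h𝔭hom) hQ' hQ𝔭 heq)
            hlt.not_ge
        · exact eq_bot_of_comap_algebraMap_eq_bot
            (h𝔭.2.2 _ (Ideal.comap_isPrime _ _) (lt_of_le_of_ne hle' heq))
end
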